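/- arXiv:2403.07989 — 3 statements merged into one kernel-verified Lean document; each statement's English description precedes it below -/
import Mathlib

section
/- In a Coxeter group W with Coxeter system (W, S), if J = {s_{i_1}, ..., s_{i_k}} ⊆ S is a set of k pairwise commuting generators with J ∩ Des(v) = ∅ for some v ∈ W, then the interval [v, v·s_{i_1}···s_{i_k}] in the right weak order of W is a Boolean lattice of rank k (isomorphic to the poset of subsets of a k-element set). -/
/-- The right weak order on a Coxeter group: `u ≤ w` iff `ℓ(u) + ℓ(u⁻¹w) = ℓ(w)`. -/
def weakLE {B W : Type*} [Group W] {M : CoxeterMatrix B} (cs : CoxeterSystem M W)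
    (u w : W) : Prop :=
  cs.length u + cs.length (u⁻¹ * w) = cs.length w

/-- The interval `[v, w]` in the right weak order is Boolean of rank `k`: it is order
isomorphic to the lattice of subsets of a `k`-element set, ordered by inclusion. -/
def IsBooleanInterval {B W : Type*} [Group W] {M : CoxeterMatrix B} (cs : CoxeterSystem M W)
    (k : ℕ) (v w : W) : Prop :=
  weakLE cs v w ∧
    ∃ f : {x : W // weakLE cs v x ∧ weakLE cs x w} ≃ Finset (Fin k),
      ∀ a b, weakLE cs a.1 b.1 ↔ f a ⊆ f b

namespace CoxAux

section Geometric

open Polynomial.Chebyshev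

/-- Entries of the doubled Gram matrix of the geometric representation. -/
noncomputable def gramEntry {B : Type*} (M : CoxeterMatrix B) (i j : B) : ℝ :=
  -(2 * Real.cos (Real.pi / (M i j : ℝ)))

/-- The linear form attached to a simple root. -/
noncomputable def rootForm {B : Type*} (M : CoxeterMatrix B) (i : B) :
    Module.Dual ℝ (B →₀ ℝ) :=
  Finsupp.linearCombination ℝ (fun j => gramEntry M i j)

lemma rootForm_single {B : Type*} (M : CoxeterMatrix B) (i j : B) :
    rootForm M i (Finsupp.single j 1) = gramEntry M i j := by
  simp [rootForm]

lemma rootForm_self {B : Type*} (M : CoxeterMatrix B) (i : B) :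
    rootForm M i (Finsupp.single i 1) = 2 := by
  rw [rootForm_single]; simp [gramEntry]

/-- Simple reflection in the geometric representation. -/
noncomputable def geomRefl {B : Type*} (M : CoxeterMatrix B) (i : B) :
    (B →₀ ℝ) ≃ₗ[ℝ] (B →₀ ℝ) :=
  Module.reflection (rootForm_self M i)

lemma geom_liftable {B : Type*} (M : CoxeterMatrix B) : M.IsLiftable (geomRefl M) := by
  intro i j
  by_cases hij : i = j
  · subst hij
    rw [M.diagonal, pow_one]
    ext1 z
    exact Module.involutive_reflection (rootForm_self M i) z
  have h1 : M i j ≠ 1 := M.off_diagonal i j hij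
  rcases Nat.lt_or_ge (M i j) 3 with h3 | h3
  · have : M i j = 0 ∨ M i j = 2 := by omega
    rcases this with h0 | h2
    · rw [h0, pow_zero]
    · have e1 : gramEntry M i j = 0 := by simp [gramEntry, h2]
      have e2 : gramEntry M j i = 0 := by rw [gramEntry, M.symmetric j i]; simp [h2]
      apply LinearEquiv.ext
      intro z
      rw [h2]
      unfold geomRefl
      rw [Module.reflection_mul_reflection_pow_apply]
      simp only [rootForm_single, e1, e2]
      norm_num [S_eval_neg_two]
      module
  · apply LinearEquiv.ext
    intro z
    set m := M i j with hm
    set θ : ℝ := 2 * Real.pi / m with hθ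
    have hmR : (3:ℝ) ≤ m := by exact_mod_cast h3
    have hmθ : (m:ℝ) * θ = 2 * Real.pi := by rw [hθ]; field_simp
    have hs : Real.sin θ ≠ 0 := by
      apply ne_of_gt
      apply Real.sin_pos_of_pos_of_lt_pi
      · rw [hθ]; have := Real.pi_pos; positivity
      · rw [hθ, div_lt_iff₀ (by linarith)]; nlinarith [Real.pi_pos]
    have ht : 2 * Real.cos θ = rootForm M i (Finsupp.single j 1) *
        rootForm M j (Finsupp.single i 1) - 2 := by
      rw [rootForm_single, rootForm_single, gramEntry, gramEntry, M.symmetric j i, ← hm,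
        show θ = 2 * (Real.pi / m) by rw [hθ]; ring, Real.cos_two_mul]
      ring
    unfold geomRefl
    rw [Module.reflection_mul_reflection_pow_apply _ _ m z _ ht]
    rcases Nat.even_or_odd' m with ⟨n, hn | hn⟩
    · have e1 : ((m:ℤ) - 2) / 2 = n - 1 := by omega
      have e2 : ((m:ℤ) - 1) / 2 = n - 1 := by omega
      have hz : (S ℝ ((n:ℤ) - 1)).eval (2 * Real.cos θ) = 0 := by
        have := S_two_mul_real_cos θ ((n:ℤ) - 1)
        push_cast at this
        rw [sub_add_cancel, show (n:ℝ) * θ = Real.pi by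
          rw [hn] at hmθ; push_cast at hmθ; linarith, Real.sin_pi] at this
        exact (mul_eq_zero.mp this).resolve_right hs
      rw [e1, e2, hz]
      simp
    · have e1 : ((m:ℤ) - 2) / 2 = n - 1 := by omega
      have e2 : ((m:ℤ) - 1) / 2 = n := by omega
      have e3 : ((m:ℤ) - 3) / 2 = n - 1 := by omega
      have e4 : ((m:ℤ)) / 2 = n := by omega
      have hz : (S ℝ (n:ℤ)).eval (2 * Real.cos θ) +
          (S ℝ ((n:ℤ) - 1)).eval (2 * Real.cos θ) = 0 := by
        have h1 := S_two_mul_real_cos θ ((n:ℤ) - 1)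
        have h2 := S_two_mul_real_cos θ (n:ℤ)
        push_cast at h1 h2
        rw [sub_add_cancel] at h1
        have h4 : ((n:ℝ) + 1) * θ = 2 * Real.pi - n * θ := by
          rw [hn] at hmθ; push_cast at hmθ; linarith
        rw [h4, Real.sin_two_pi_sub] at h2
        have : ((S ℝ (n:ℤ)).eval (2 * Real.cos θ) +
          (S ℝ ((n:ℤ) - 1)).eval (2 * Real.cos θ)) * Real.sin θ = 0 := by
          rw [add_mul, h1, h2]; ring
        exact (mul_eq_zero.mp this).resolve_right hs
      rw [e1, e2, e3, e4, hz]
      simp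

theorem simple_injective {B W : Type*} [Group W] {M : CoxeterMatrix B}
    (cs : CoxeterSystem M W) : Function.Injective cs.simple := by
  intro i j h
  by_contra hij
  have h1 := congrArg (cs.lift ⟨_, geom_liftable M⟩) h
  rw [cs.lift_apply_simple, cs.lift_apply_simple] at h1
  have h2 := DFunLike.congr_fun (LinearEquiv.congr_fun h1 (Finsupp.single i 1)) i
  unfold geomRefl at h2
  rw [Module.reflection_apply_self, Module.reflection_apply] at h2
  simp [Ne.symm hij] at h2
  norm_num at h2

end Geometric

section Exchange

open Classical in
/-- The Tits action of a simple reflection on `W × ℤ/2`. -/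
noncomputable def titsFun {W : Type*} [Group W] (s : W) (p : W × ZMod 2) : W × ZMod 2 :=
  (s * p.1 * s, p.2 + if p.1 = s then 1 else 0)

/-- Same action, as an element of the monoid of endomaps. -/
noncomputable def titsEnd {W : Type*} [Group W] (s : W) : Function.End (W × ZMod 2) := titsFun s

variable {B W : Type*} [Group W] {M : CoxeterMatrix B} (cs : CoxeterSystem M W)

open Classical in
lemma tits_pow (i j : B) (n : ℕ) (t : W) (e : ZMod 2) :
    ((titsEnd (cs.simple i) * titsEnd (cs.simple j)) ^ n : Function.End (W × ZMod 2)) (t, e) =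
      ((cs.simple i * cs.simple j) ^ n * t * ((cs.simple i * cs.simple j) ^ n)⁻¹,
        e + ∑ k ∈ Finset.range (2 * n),
          if t = ((cs.simple i * cs.simple j) ^ k)⁻¹ * cs.simple j then (1 : ZMod 2) else 0) := by
  induction n with
  | zero => simp; rfl
  | succ n ih =>
    rw [pow_succ']
    change titsFun (cs.simple i) (titsFun (cs.simple j)
      (((titsEnd (cs.simple i) * titsEnd (cs.simple j)) ^ n : Function.End (W × ZMod 2)) (t, e))) = _
    rw [ih]
    generalize hx : cs.simple i * cs.simple j = x
    have hxi : x⁻¹ = cs.simple j * cs.simple i := by simp [← hx]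
    have hsc : SemiconjBy (cs.simple j) x x⁻¹ := by
      unfold SemiconjBy
      rw [hxi, ← hx, mul_assoc]
    have hc : cs.simple j * x ^ n = (x ^ n)⁻¹ * cs.simple j := by
      rw [← inv_pow]; exact hsc.pow_right n
    have c1 : (x ^ n * t * (x ^ n)⁻¹ = cs.simple j) ↔ t = (x ^ (2 * n))⁻¹ * cs.simple j := by
      rw [mul_inv_eq_iff_eq_mul, hc, ← eq_inv_mul_iff_mul_eq, ← mul_assoc, ← mul_inv_rev,
        ← pow_add, two_mul]
    have c2 : (cs.simple j * (x ^ n * t * (x ^ n)⁻¹) * cs.simple j = cs.simple i) ↔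
        t = (x ^ (2 * n + 1))⁻¹ * cs.simple j := by
      have : (cs.simple j * (x ^ n * t * (x ^ n)⁻¹) * cs.simple j = cs.simple i) ↔
          (x ^ n * t * (x ^ n)⁻¹ = x⁻¹ * cs.simple j) := by
        rw [hxi]
        constructor
        · intro h
          rw [← h]; simp [mul_assoc]
        · intro h
          rw [h]; simp [mul_assoc]
      rw [this, mul_inv_eq_iff_eq_mul, mul_assoc x⁻¹, hc, ← eq_inv_mul_iff_mul_eq, ← mul_assoc,
        ← mul_assoc, ← mul_inv_rev, ← mul_inv_rev, ← pow_succ', ← pow_add,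
        show n + (n + 1) = 2 * n + 1 by ring]
    rw [show 2 * (n + 1) = 2 * n + 1 + 1 by ring, Finset.sum_range_succ, Finset.sum_range_succ]
    simp only [titsFun, c1, c2]
    ext
    · simp only
      rw [pow_succ' x n, mul_inv_rev, hxi, ← hx]
      simp [mul_assoc]
    · simp only
      ring

lemma tits_liftable : M.IsLiftable (fun i => titsEnd (cs.simple i)) := by
  classical
  intro i j
  funext p
  obtain ⟨t, e⟩ := p
  rw [tits_pow, cs.simple_mul_simple_pow, two_mul, Finset.sum_range_add]
  simp only [pow_add, cs.simple_mul_simple_pow, one_mul]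
  rw [CharTwo.add_self_eq_zero]
  simp
  rfl

open Classical in
lemma tits_word (ω : List B) (t : W) (e : ZMod 2) :
    (cs.lift ⟨_, tits_liftable cs⟩ (cs.wordProd ω)) (t, e) =
      (cs.wordProd ω * t * (cs.wordProd ω)⁻¹, e + ((cs.rightInvSeq ω).count t : ZMod 2)) := by
  induction ω with
  | nil => simp; rfl
  | cons i ω ih =>
    rw [cs.wordProd_cons, map_mul, cs.lift_apply_simple]
    change titsFun (cs.simple i) (_) = _
    rw [ih, titsFun, CoxeterSystem.rightInvSeq, List.count_cons]
    have : (cs.wordProd ω * t * (cs.wordProd ω)⁻¹ = cs.simple i) ↔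
      ((cs.wordProd ω)⁻¹ * cs.simple i * cs.wordProd ω = t) := by
      constructor
      · intro h; rw [← h]; group
      · intro h; rw [← h]; group
    simp only [this, beq_iff_eq]
    ext
    · simp [mul_assoc]
    · simp [add_assoc]

theorem exchange (ω : List B) (i : B) (h : cs.IsRightDescent (cs.wordProd ω) i) :
    ∃ j < ω.length, cs.wordProd ω * cs.simple i = cs.wordProd (ω.eraseIdx j) := by
  classical
  have hmem : cs.simple i ∈ cs.rightInvSeq ω := by
    by_contra hn
    obtain ⟨ω', hr, hω'⟩ := cs.exists_isReduced (cs.wordProd ω * cs.simple i)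
    have h1 := tits_word cs ω' (cs.simple i) 0
    rw [← hω', map_mul, cs.lift_apply_simple] at h1
    change (cs.lift ⟨_, tits_liftable cs⟩ (cs.wordProd ω)) (titsFun (cs.simple i) (cs.simple i, 0)) = _ at h1
    rw [titsFun] at h1
    simp only [if_true] at h1
    rw [tits_word] at h1
    have h2 := congrArg Prod.snd h1
    simp only [cs.simple_mul_simple_self, one_mul, List.count_eq_zero_of_not_mem hn] at h2
    have hm : cs.simple i ∈ cs.rightInvSeq ω' := by
      by_contra hn'
      rw [List.count_eq_zero_of_not_mem hn'] at h2
      simp at h2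
    have h3 := (cs.isRightInversion_of_mem_rightInvSeq hr hm).2
    rw [← hω'] at h3
    unfold CoxeterSystem.IsRightDescent at h
    simp at h3
    omega
  obtain ⟨j, hj, hje⟩ := List.mem_iff_getElem.mp hmem
  refine ⟨j, by simpa using hj, ?_⟩
  rw [← cs.wordProd_mul_getD_rightInvSeq, List.getD_eq_getElem _ 1 hj, hje]

end Exchange

section Main

variable {B W : Type*} [Group W] {M : CoxeterMatrix B} (cs : CoxeterSystem M W)
  {k : ℕ} (f : Fin k → B)

lemma wordProd_perm
    (hcomm : ∀ a b : Fin k,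
      cs.simple (f a) * cs.simple (f b) = cs.simple (f b) * cs.simple (f a))
    {l l' : List (Fin k)} (h : l.Perm l') :
    cs.wordProd (l.map f) = cs.wordProd (l'.map f) := by
  unfold CoxeterSystem.wordProd
  apply List.Perm.prod_eq'
  · exact (h.map f).map cs.simple
  · rw [List.map_map, List.pairwise_map]
    exact List.pairwise_of_forall fun a b => hcomm a b

lemma wordProd_comm
    (hcomm : ∀ a b : Fin k,
      cs.simple (f a) * cs.simple (f b) = cs.simple (f b) * cs.simple (f a))
    (l : List (Fin k)) (a : Fin k) :
    cs.simple (f a) * cs.wordProd (l.map f) = cs.wordProd (l.map f) * cs.simple (f a) := by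
  rw [← cs.wordProd_cons, ← cs.wordProd_concat, ← List.map_cons, ← List.map_concat]
  apply wordProd_perm cs f hcomm
  simpa using (List.perm_append_singleton a l).symm

lemma eq_of_erase
    (hcomm : ∀ a b : Fin k,
      cs.simple (f a) * cs.simple (f b) = cs.simple (f b) * cs.simple (f a))
    (l : List (Fin k)) (n : ℕ) (hn : n < l.length) (i : B)
    (h : cs.wordProd (l.map f) * cs.simple i = cs.wordProd ((l.map f).eraseIdx n)) :
    ∃ b ∈ l, cs.simple i = cs.simple (f b) := by
  refine ⟨l[n], List.getElem_mem hn, ?_⟩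
  have hp := wordProd_perm cs f hcomm (List.getElem_cons_eraseIdx_perm hn)
  rw [List.map_cons, cs.wordProd_cons, wordProd_comm cs f hcomm] at hp
  rw [List.eraseIdx_map, ← hp, mul_assoc] at h
  have := mul_eq_left.mp h
  rw [eq_comm, ← inv_eq_of_mul_eq_one_right this, cs.inv_simple]

lemma length_mul_wordProd
    (hinj : Function.Injective f)
    (hcomm : ∀ a b : Fin k,
      cs.simple (f a) * cs.simple (f b) = cs.simple (f b) * cs.simple (f a))
    (v : W) (hdes : ∀ a : Fin k, ¬ cs.IsRightDescent v (f a))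
    (l : List (Fin k)) (hl : l.Nodup) :
    cs.length (v * cs.wordProd (l.map f)) = cs.length v + l.length := by
  induction l with
  | nil => simp
  | cons a l ih =>
    rw [List.nodup_cons] at hl
    have ih := ih hl.2
    rw [List.map_cons, cs.wordProd_cons, wordProd_comm cs f hcomm, ← mul_assoc]
    have key : ¬ cs.IsRightDescent (v * cs.wordProd (l.map f)) (f a) := by
      intro hd
      obtain ⟨ω, hr, hω⟩ := cs.exists_isReduced v
      rw [hω, ← cs.wordProd_append] at hd
      obtain ⟨j, hj, he⟩ := exchange cs _ _ hd
      rcases Nat.lt_or_ge j ω.length with hlt | hge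
      · rw [List.eraseIdx_append_of_lt_length hlt, cs.wordProd_append, cs.wordProd_append,
          mul_assoc, ← wordProd_comm cs f hcomm, ← mul_assoc] at he
        have he := mul_right_cancel he
        apply hdes a
        unfold CoxeterSystem.IsRightDescent
        rw [hω, he, hr.eq]
        have h1 := cs.length_wordProd_le (ω.eraseIdx j)
        have h2 := List.length_eraseIdx_add_one hlt
        omega
      · rw [List.eraseIdx_append_of_length_le hge, cs.wordProd_append, cs.wordProd_append,
          mul_assoc] at he
        have he := mul_left_cancel he
        obtain ⟨b, hb, hab⟩ := eq_of_erase cs f hcomm l (j - ω.length)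
          (by simp at hj; omega) (f a) he
        have := hinj (simple_injective cs hab)
        subst this
        exact hl.1 hb
    rw [cs.not_isRightDescent_iff] at key
    rw [key, ih, List.length_cons]
    ring

/-- Product of the generators indexed by a finite set. -/
noncomputable def setProd (A : Finset (Fin k)) : W := cs.wordProd (A.toList.map f)

lemma length_mul_setProd
    (hinj : Function.Injective f)
    (hcomm : ∀ a b : Fin k,
      cs.simple (f a) * cs.simple (f b) = cs.simple (f b) * cs.simple (f a))
    (v : W) (hdes : ∀ a : Fin k, ¬ cs.IsRightDescent v (f a)) (A : Finset (Fin k)) :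
    cs.length (v * setProd cs f A) = cs.length v + A.card := by
  rw [setProd, length_mul_wordProd cs f hinj hcomm v hdes _ A.nodup_toList, Finset.length_toList]

lemma length_setProd
    (hinj : Function.Injective f)
    (hcomm : ∀ a b : Fin k,
      cs.simple (f a) * cs.simple (f b) = cs.simple (f b) * cs.simple (f a))
    (A : Finset (Fin k)) :
    cs.length (setProd cs f A) = A.card := by
  have := length_mul_setProd cs f hinj hcomm 1 (fun a => cs.not_isRightDescent_one _) A
  simpa using this

lemma setProd_empty : setProd cs f ∅ = 1 := by simp [setProd]

lemma setProd_insert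
    (hcomm : ∀ a b : Fin k,
      cs.simple (f a) * cs.simple (f b) = cs.simple (f b) * cs.simple (f a))
    (a : Fin k) (A : Finset (Fin k)) (h : a ∉ A) :
    setProd cs f (insert a A) = cs.simple (f a) * setProd cs f A := by
  rw [setProd, wordProd_perm cs f hcomm (Finset.toList_insert h), List.map_cons, cs.wordProd_cons,
    setProd]

lemma simple_mul_setProd
    (hcomm : ∀ a b : Fin k,
      cs.simple (f a) * cs.simple (f b) = cs.simple (f b) * cs.simple (f a))
    (a : Fin k) (A : Finset (Fin k)) :
    cs.simple (f a) * setProd cs f A = setProd cs f (symmDiff {a} A) := by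
  by_cases h : a ∈ A
  · have h1 : symmDiff {a} A = A.erase a := by
      ext b; by_cases hb : b = a <;> simp [Finset.mem_symmDiff, hb, h]
    have h2 := setProd_insert cs f hcomm a (A.erase a) (by simp)
    rw [Finset.insert_erase h] at h2
    rw [h1, h2, cs.simple_mul_simple_cancel_left]
  · have h1 : symmDiff {a} A = insert a A := by
      ext b; by_cases hb : b = a <;> simp [Finset.mem_symmDiff, hb, h]
    rw [h1, setProd_insert cs f hcomm a A h]

lemma setProd_mul
    (hcomm : ∀ a b : Fin k,
      cs.simple (f a) * cs.simple (f b) = cs.simple (f b) * cs.simple (f a))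
    (A C : Finset (Fin k)) :
    setProd cs f A * setProd cs f C = setProd cs f (symmDiff A C) := by
  induction A using Finset.induction_on with
  | empty =>
    rw [setProd_empty, one_mul]
    congr 1
    ext b; simp [Finset.mem_symmDiff]
  | insert a A ha ih =>
    rw [setProd_insert cs f hcomm a A ha, mul_assoc, ih, simple_mul_setProd cs f hcomm,
      ← symmDiff_assoc]
    congr 2
    ext b; by_cases hb : b = a <;> simp [Finset.mem_symmDiff, hb, ha]

lemma setProd_inv
    (hcomm : ∀ a b : Fin k,
      cs.simple (f a) * cs.simple (f b) = cs.simple (f b) * cs.simple (f a))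
    (A : Finset (Fin k)) : (setProd cs f A)⁻¹ = setProd cs f A := by
  apply inv_eq_of_mul_eq_one_right
  rw [setProd_mul cs f hcomm, symmDiff_self, Finset.bot_eq_empty, setProd_empty]

lemma exists_of_below
    (hinj : Function.Injective f)
    (hcomm : ∀ a b : Fin k,
      cs.simple (f a) * cs.simple (f b) = cs.simple (f b) * cs.simple (f a))
    (n : ℕ) : ∀ (y : W) (A : Finset (Fin k)), cs.length y = n →
      cs.length y + cs.length (y⁻¹ * setProd cs f A) = A.card → ∃ C, y = setProd cs f C := by
  induction n with
  | zero =>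
    intro y A hy _
    refine ⟨∅, ?_⟩
    rw [setProd_empty]
    exact cs.length_eq_zero_iff.mp hy
  | succ n ih =>
    intro y A hy hA
    have hy1 : y ≠ 1 := by rintro rfl; simp at hy
    obtain ⟨i, hi⟩ := cs.exists_leftDescent_of_ne_one hy1
    rw [cs.isLeftDescent_iff] at hi
    have hd : cs.IsRightDescent (setProd cs f A) i := by
      rw [← setProd_inv cs f hcomm, cs.isRightDescent_inv_iff]
      unfold CoxeterSystem.IsLeftDescent
      have h1 := cs.length_mul_le (cs.simple i * y) (y⁻¹ * setProd cs f A)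
      rw [mul_assoc, mul_inv_cancel_left] at h1
      rw [length_setProd cs f hinj hcomm]
      omega
    obtain ⟨j, hj, he⟩ := exchange cs _ _ hd
    obtain ⟨b, hb, hib⟩ := eq_of_erase cs f hcomm _ j (by simpa using hj) i he
    rw [Finset.mem_toList] at hb
    rw [hib] at hi
    have h2 := setProd_insert cs f hcomm b (A.erase b) (by simp)
    rw [Finset.insert_erase hb] at h2
    have hc := Finset.card_erase_add_one hb
    obtain ⟨C, hC⟩ := ih (cs.simple (f b) * y) (A.erase b) (by omega) (by
      rw [mul_inv_rev, cs.inv_simple, mul_assoc, ← h2]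
      omega)
    refine ⟨symmDiff {b} C, ?_⟩
    rw [← simple_mul_setProd cs f hcomm, ← hC, cs.simple_mul_simple_cancel_left]

lemma card_symmDiff_iff (A C : Finset (Fin k)) :
    A.card + (symmDiff A C).card = C.card ↔ A ⊆ C := by
  have h1 : (symmDiff A C).card = (A \ C).card + (C \ A).card := by
    rw [symmDiff, Finset.sup_eq_union, Finset.card_union_of_disjoint disjoint_sdiff_sdiff]
  have h2 := Finset.card_sdiff_add_card_inter A C
  have h3 := Finset.card_sdiff_add_card_inter C A
  rw [Finset.inter_comm] at h3
  rw [← Finset.sdiff_eq_empty_iff_subset, ← Finset.card_eq_zero]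
  omega

end Main
end CoxAux

/-- If `J = {s_{i₁}, …, s_{i_k}} ⊆ S` is a set of `k` pairwise commuting
generators with `J ∩ Des(v) = ∅`, then `[v, v·s_{i₁}⋯s_{i_k}]` is a Boolean interval of
rank `k` in the right weak order. -/
theorem isBooleanInterval_of_commuting_nondescents {B W : Type*} [Group W]
    {M : CoxeterMatrix B} (cs : CoxeterSystem M W) (k : ℕ) (f : Fin k → B)
    (hinj : Function.Injective f)
    (hcomm : ∀ a b : Fin k,
      cs.simple (f a) * cs.simple (f b) = cs.simple (f b) * cs.simple (f a))
    (v : W) (hdes : ∀ a : Fin k, ¬ cs.IsRightDescent v (f a)) :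
    IsBooleanInterval cs k v (v * (List.ofFn fun a => cs.simple (f a)).prod) := by
  have hw : (List.ofFn fun a => cs.simple (f a)).prod = CoxAux.setProd cs f Finset.univ := by
    have hp : (List.finRange k).Perm (Finset.univ : Finset (Fin k)).toList := by
      apply (List.perm_ext_iff_of_nodup (List.nodup_finRange k) (Finset.nodup_toList _)).mpr
      simp
    rw [CoxAux.setProd, ← CoxAux.wordProd_perm cs f hcomm hp, CoxeterSystem.wordProd,
      List.map_map, List.ofFn_eq_map]
    rfl
  rw [hw]
  have hlen := CoxAux.length_mul_setProd cs f hinj hcomm v hdes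
  have hle : ∀ A C : Finset (Fin k),
      weakLE cs (v * CoxAux.setProd cs f A) (v * CoxAux.setProd cs f C) ↔ A ⊆ C := by
    intro A C
    unfold weakLE
    rw [hlen, hlen, mul_inv_rev, mul_assoc, inv_mul_cancel_left, CoxAux.setProd_inv cs f hcomm,
      CoxAux.setProd_mul cs f hcomm, CoxAux.length_setProd cs f hinj hcomm,
      ← CoxAux.card_symmDiff_iff]
    omega
  have hbot : ∀ C : Finset (Fin k), weakLE cs v (v * CoxAux.setProd cs f C) := by
    intro C
    have := (hle ∅ C).mpr (Finset.empty_subset C)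
    rwa [CoxAux.setProd_empty, mul_one] at this
  refine ⟨hbot _, ?_⟩
  let g : Finset (Fin k) → {x : W // weakLE cs v x ∧
      weakLE cs x (v * CoxAux.setProd cs f Finset.univ)} := fun A =>
    ⟨v * CoxAux.setProd cs f A, hbot A, (hle _ _).mpr (Finset.subset_univ A)⟩
  have hg : Function.Bijective g := by
    constructor
    · intro A C h
      have h : v * CoxAux.setProd cs f A = v * CoxAux.setProd cs f C := congrArg Subtype.val h
      apply Finset.Subset.antisymm
      · rw [← hle, ← h, hle]
      · rw [← hle, ← h, hle]
    · rintro ⟨x, h1, h2⟩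
      obtain ⟨C, hC⟩ := CoxAux.exists_of_below cs f hinj hcomm _ (v⁻¹ * x) Finset.univ rfl (by
        unfold weakLE at h1 h2
        rw [hlen] at h2
        rw [mul_inv_rev, inv_inv, mul_assoc]
        omega)
      refine ⟨C, Subtype.ext ?_⟩
      change v * CoxAux.setProd cs f C = x
      rw [← hC, mul_inv_cancel_left]
  refine ⟨(Equiv.ofBijective g hg).symm, ?_⟩
  intro a b
  obtain ⟨A, rfl⟩ := (Equiv.ofBijective g hg).surjective a
  obtain ⟨C, rfl⟩ := (Equiv.ofBijective g hg).surjective b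
  rw [Equiv.symm_apply_apply, Equiv.symm_apply_apply]
  exact hle A C
end

section
/- For a finite Coxeter group W with Coxeter graph Γ_W, the number of Boolean intervals of rank k in the right weak order of W equals i_k(Γ_W) · |W| / 2^k, where i_k(Γ_W) is the number of independent sets of size k in Γ_W. -/
namespace BoolInt

section geom
variable {B : Type*} (M : CoxeterMatrix B)

/-- The linear functional of the geometric representation. -/
noncomputable def gf (i : B) : Module.Dual ℝ (B →₀ ℝ) :=
  Finsupp.linearCombination ℝ (fun j => -2 * Real.cos (Real.pi / M i j))

lemma gf_single (i j : B) : gf M i (Finsupp.single j 1) = -2 * Real.cos (Real.pi / M i j) := by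
  simp [gf]

lemma gf_self (i : B) : gf M i (Finsupp.single i 1) = 2 := by
  rw [gf_single]; simp

/-- The generating reflections of the geometric representation. -/
noncomputable def gr (i : B) : (B →₀ ℝ) ≃ₗ[ℝ] (B →₀ ℝ) := Module.reflection (gf_self M i)

lemma gr_apply (i : B) (v : B →₀ ℝ) : gr M i v = v - gf M i v • Finsupp.single i 1 :=
  Module.reflection_apply _ _

lemma gr_liftable : M.IsLiftable (gr M) := by
  intro i j
  by_cases hij : i = j
  · subst hij
    ext v
    simp [gr, Module.involutive_reflection (gf_self M i) _]
  have hsym : gf M j (Finsupp.single i 1) = gf M i (Finsupp.single j 1) := by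
    rw [gf_single, gf_single, M.symmetric i j]
  have h1 := M.off_diagonal i j hij
  obtain ⟨m, hm⟩ : ∃ m, M i j = m := ⟨_, rfl⟩
  have hc := gf_single M i j
  rw [hm] at hc ⊢
  have h1' : m ≠ 1 := by rw [← hm]; exact h1
  by_cases h0 : m = 0
  · subst h0; simp
  by_cases h2 : m = 2
  · subst h2
    have hc0 : gf M i (Finsupp.single j 1) = 0 := by rw [hc]; simp
    rw [hc0] at hsym
    apply LinearEquiv.ext
    intro v
    simp only [pow_two, LinearEquiv.mul_apply, gr_apply, map_sub, map_smul, hc0, hsym, gf_self,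
      LinearEquiv.coe_one, id]
    module
  have h3 : 3 ≤ m := by omega
  have hmR : (3 : ℝ) ≤ m := by exact_mod_cast h3
  set θ : ℝ := 2 * Real.pi / m with hθ
  have hmθ : (m : ℝ) * θ = 2 * Real.pi := by rw [hθ]; field_simp
  have hθpos : 0 < θ := by positivity
  have hθlt : θ < Real.pi := by
    rw [hθ, div_lt_iff₀ (by linarith)]
    nlinarith [Real.pi_pos]
  have hsin : Real.sin θ ≠ 0 := (Real.sin_pos_of_pos_of_lt_pi hθpos hθlt).ne'
  have ht : 2 * Real.cos θ = gf M i (Finsupp.single j 1) * gf M j (Finsupp.single i 1) - 2 := by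
    rw [hsym, hc, show θ = 2 * (Real.pi / m) by rw [hθ]; ring, Real.cos_two_mul]
    ring
  have key := fun z => Module.reflection_mul_reflection_pow_apply (gf_self M i) (gf_self M j) m z
    (2 * Real.cos θ) ht
  have hS := Polynomial.Chebyshev.S_two_mul_real_cos θ
  apply LinearEquiv.ext
  intro z
  refine (key z).trans ?_
  obtain ⟨p, hp | hp⟩ := Nat.even_or_odd' m
  · have e1 : ((m : ℤ) - 2) / 2 = p - 1 := by omega
    have e2 : ((m : ℤ) - 1) / 2 = p - 1 := by omega
    have hz : (Polynomial.Chebyshev.S ℝ ((p : ℤ) - 1)).eval (2 * Real.cos θ) = 0 := by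
      have := hS ((p : ℤ) - 1)
      have e : (((p : ℤ) - 1 : ℤ) : ℝ) + 1 = p := by push_cast; ring
      rw [e, show (p : ℝ) * θ = Real.pi by
        have : (m : ℝ) = 2 * p := by exact_mod_cast hp
        rw [this] at hmθ; linarith, Real.sin_pi] at this
      exact (mul_eq_zero.1 this).resolve_right hsin
    rw [e1, e2, hz]
    simp
  · have e1 : ((m : ℤ) - 2) / 2 = p - 1 := by omega
    have e2 : ((m : ℤ) - 1) / 2 = p := by omega
    have e3 : ((m : ℤ) - 3) / 2 = p - 1 := by omega
    have e4 : (m : ℤ) / 2 = p := by omega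
    have hz : (Polynomial.Chebyshev.S ℝ (p : ℤ)).eval (2 * Real.cos θ) +
        (Polynomial.Chebyshev.S ℝ ((p : ℤ) - 1)).eval (2 * Real.cos θ) = 0 := by
      have a1 := hS ((p : ℤ) - 1)
      have a2 := hS (p : ℤ)
      have e : (((p : ℤ) - 1 : ℤ) : ℝ) + 1 = p := by push_cast; ring
      rw [e] at a1
      have e' : (((p : ℤ) : ℝ) + 1) * θ = 2 * Real.pi - p * θ := by
        have : (m : ℝ) = 2 * p + 1 := by exact_mod_cast hp
        rw [this] at hmθ
        push_cast
        linarith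
      rw [e', Real.sin_two_pi_sub] at a2
      have : ((Polynomial.Chebyshev.S ℝ (p : ℤ)).eval (2 * Real.cos θ) +
        (Polynomial.Chebyshev.S ℝ ((p : ℤ) - 1)).eval (2 * Real.cos θ)) * Real.sin θ = 0 := by
        rw [add_mul, a1, a2]; ring
      exact (mul_eq_zero.1 this).resolve_right hsin
    rw [e1, e2, e3, e4, hz]
    simp

variable {M} {W : Type*} [Group W] (cs : CoxeterSystem M W)

lemma simple_inj : Function.Injective cs.simple := by
  intro i j h
  by_contra hij
  have h' := congrArg (cs.lift ⟨gr M, gr_liftable M⟩) h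
  rw [cs.lift_apply_simple, cs.lift_apply_simple] at h'
  have h2 := DFunLike.congr_fun (DFunLike.congr_fun h' (Finsupp.single i 1)) i
  rw [gr_apply, gr_apply, gf_self] at h2
  simp [Ne.symm hij] at h2

lemma eq_two_of_commute {i j : B} (hij : i ≠ j)
    (h : cs.simple i * cs.simple j = cs.simple j * cs.simple i) : M i j = 2 := by
  have h' := congrArg (cs.lift ⟨gr M, gr_liftable M⟩) h
  rw [map_mul, map_mul, cs.lift_apply_simple, cs.lift_apply_simple] at h'
  have h2 := DFunLike.congr_fun (DFunLike.congr_fun h' (Finsupp.single j 1)) i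
  simp only [LinearEquiv.mul_apply, gr_apply, map_sub, map_smul, gf_self] at h2
  have hc := gf_single M i j
  simp [Ne.symm hij] at h2
  have hc0 : Real.cos (Real.pi / M i j) = 0 := by linarith
  by_contra hne
  have h1 := M.off_diagonal i j hij
  by_cases h0 : M i j = 0
  · rw [h0] at hc0; simp at hc0
  have h3 : (3 : ℝ) ≤ M i j := by
    have : 3 ≤ M i j := by omega
    exact_mod_cast this
  have : 0 < Real.cos (Real.pi / M i j) := by
    apply Real.cos_pos_of_mem_Ioo
    constructor
    · have : 0 < Real.pi / M i j := by positivity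
      linarith [Real.pi_pos]
    · rw [div_lt_iff₀ (by linarith)]
      nlinarith [Real.pi_pos]
  linarith

lemma commute_of_eq_two {i j : B} (h : M i j = 2) : Commute (cs.simple i) (cs.simple j) := by
  have h1 := cs.simple_mul_simple_pow i j
  rw [h, pow_two] at h1
  have h2 := eq_inv_of_mul_eq_one_left h1
  rw [mul_inv_rev, cs.inv_simple, cs.inv_simple] at h2
  exact h2

end geom

section cocycle
open scoped Classical
variable {B : Type*} {M : CoxeterMatrix B} {W : Type*} [Group W] (cs : CoxeterSystem M W)

/-- The generators of the action on `W × ZMod 2` used for the exchange property. -/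
noncomputable def sg (i : B) : Function.End (W × ZMod 2) := fun p =>
  (cs.simple i * p.1 * cs.simple i, p.2 + if p.1 = cs.simple i then 1 else 0)

lemma sg_pow (i j : B) (n : ℕ) (t : W) (e : ZMod 2) :
    ((sg cs i * sg cs j) ^ n : Function.End (W × ZMod 2)) (t, e) =
      ((cs.simple i * cs.simple j) ^ n * t * (cs.simple j * cs.simple i) ^ n,
        e + ∑ k ∈ Finset.range (2 * n),
          if t = (cs.simple j * cs.simple i) ^ k * cs.simple j then 1 else 0) := by
  induction n with
  | zero => simp; rfl
  | succ n ih =>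
    rw [pow_succ' (sg cs i * sg cs j)]
    change sg cs i (sg cs j (((sg cs i * sg cs j) ^ n : Function.End (W × ZMod 2)) (t, e))) = _
    rw [ih]
    set a := cs.simple i with ha
    set b := cs.simple j with hb
    have haa : a * a = 1 := cs.simple_mul_simple_self i
    have hbb : b * b = 1 := cs.simple_mul_simple_self j
    have ia : a⁻¹ = a := cs.inv_simple i
    have ib : b⁻¹ = b := cs.inv_simple j
    have hinv : ((b * a) ^ n)⁻¹ = (a * b) ^ n := by
      rw [← inv_pow, mul_inv_rev, ia, ib]
    have hinv2 : ((a * b) ^ n)⁻¹ = (b * a) ^ n := by rw [← hinv, inv_inv]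
    have hcomm : ∀ n : ℕ, b * (a * b) ^ n = (b * a) ^ n * b := by
      intro n
      induction n with
      | zero => simp
      | succ n ih => rw [pow_succ, ← mul_assoc, ih, pow_succ]; simp only [mul_assoc]
    have c1 : ((a * b) ^ n * t * (b * a) ^ n = b) ↔ t = (b * a) ^ (2 * n) * b := by
      rw [mul_assoc, ← eq_inv_mul_iff_mul_eq, ← eq_mul_inv_iff_mul_eq, hinv, hinv2, mul_assoc,
        hcomm, two_mul, pow_add]
      simp only [mul_assoc]
    have c2 : (b * ((a * b) ^ n * t * (b * a) ^ n) * b = a) ↔ t = (b * a) ^ (2 * n + 1) * b := by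
      rw [← eq_mul_inv_iff_mul_eq, ib, ← eq_inv_mul_iff_mul_eq, ib, mul_assoc,
        ← eq_inv_mul_iff_mul_eq, ← eq_mul_inv_iff_mul_eq, hinv, hinv2]
      have : (b * a) ^ n * (b * (a * b)) * (a * b) ^ n = (b * a) ^ (2 * n + 1) * b := by
        calc (b * a) ^ n * (b * (a * b)) * (a * b) ^ n
            = (b * a) ^ n * (b * a) * (b * (a * b) ^ n) := by simp only [mul_assoc]
          _ = _ := by rw [hcomm, ← pow_succ, ← mul_assoc, ← pow_add]; congr 2; ring
      rw [← this]
    refine Prod.ext ?_ ?_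
    · simp only [sg, ← ha, ← hb]
      rw [pow_succ', pow_succ]
      simp only [mul_assoc]
    · simp only [sg, ← ha, ← hb]
      rw [show 2 * (n + 1) = 2 * n + 1 + 1 by ring, Finset.sum_range_succ, Finset.sum_range_succ]
      simp only [c1, c2]
      ring

lemma sg_liftable : M.IsLiftable (sg cs) := by
  intro i j
  funext p
  obtain ⟨t, e⟩ := p
  rw [sg_pow]
  change _ = (t, e)
  have h1 : (cs.simple i * cs.simple j) ^ M i j = 1 := cs.simple_mul_simple_pow i j
  have h2 : (cs.simple j * cs.simple i) ^ M i j = 1 := cs.simple_mul_simple_pow' i j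
  rw [h1, h2, two_mul, Finset.sum_range_add]
  simp only [pow_add, h2, one_mul, mul_one]
  refine Prod.ext rfl ?_
  rw [CharTwo.add_self_eq_zero, add_zero]

/-- The reflection cocycle. -/
noncomputable def eta (w t : W) : ZMod 2 := (cs.lift ⟨sg cs, sg_liftable cs⟩ w (t, 0)).2

lemma lift_word (ω : List B) (t : W) (e : ZMod 2) :
    cs.lift ⟨sg cs, sg_liftable cs⟩ (cs.wordProd ω) (t, e) =
      (cs.wordProd ω * t * (cs.wordProd ω)⁻¹, e + ((cs.rightInvSeq ω).count t : ℕ)) := by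
  induction ω with
  | nil => simp; rfl
  | cons i ω ih =>
    rw [cs.wordProd_cons, map_mul, cs.lift_apply_simple]
    change sg cs i (cs.lift ⟨sg cs, sg_liftable cs⟩ (cs.wordProd ω) (t, e)) = _
    rw [ih]
    refine Prod.ext ?_ ?_
    · simp [sg, mul_assoc]
    · have : (cs.wordProd ω * t * (cs.wordProd ω)⁻¹ = cs.simple i) ↔
          ((cs.wordProd ω)⁻¹ * cs.simple i * cs.wordProd ω) = t := by
        constructor
        · intro h; rw [← h]; group
        · intro h; rw [← h]; group
      simp only [sg, CoxeterSystem.rightInvSeq, List.count_cons, this, beq_iff_eq]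
      push_cast
      ring

lemma lift_eq (w t : W) (e : ZMod 2) :
    cs.lift ⟨sg cs, sg_liftable cs⟩ w (t, e) = (w * t * w⁻¹, e + eta cs w t) := by
  obtain ⟨ω, rfl⟩ := cs.wordProd_surjective w
  rw [eta, lift_word, lift_word, zero_add]

lemma eta_mul (w w' t : W) : eta cs (w * w') t = eta cs w' t + eta cs w (w' * t * w'⁻¹) := by
  have : cs.lift ⟨sg cs, sg_liftable cs⟩ (w * w') (t, 0) =
    cs.lift ⟨sg cs, sg_liftable cs⟩ w (cs.lift ⟨sg cs, sg_liftable cs⟩ w' (t, 0)) := by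
    rw [map_mul]; rfl
  rw [lift_eq, lift_eq, lift_eq] at this
  simpa using congrArg Prod.snd this

lemma eta_simple (i : B) (t : W) : eta cs (cs.simple i) t = if t = cs.simple i then 1 else 0 := by
  rw [eta, cs.lift_apply_simple]; simp [sg]

lemma eta_one (t : W) : eta cs 1 t = 0 := by
  rw [eta, map_one]; rfl

lemma zmod2 (x : ZMod 2) : x = 0 ∨ x = 1 := by revert x; decide

lemma descent_of_eta {w : W} {i : B} (h : eta cs w (cs.simple i) = 1) :
    cs.IsRightDescent w i := by
  obtain ⟨ω, hω, rfl⟩ := cs.exists_isReduced w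
  rw [eta, lift_word, zero_add] at h
  have hm : cs.simple i ∈ cs.rightInvSeq ω := by
    by_contra hn
    rw [List.count_eq_zero_of_not_mem hn] at h
    simp at h
  exact (cs.isRightInversion_of_mem_rightInvSeq hω hm).2

lemma eta_iff (w : W) (i : B) : eta cs w (cs.simple i) = 1 ↔ cs.IsRightDescent w i := by
  refine ⟨descent_of_eta cs, fun h => ?_⟩
  rcases zmod2 (eta cs w (cs.simple i)) with h0 | h0
  · exfalso
    have : eta cs (w * cs.simple i) (cs.simple i) = 1 := by
      rw [eta_mul, eta_simple]; simp [h0]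
    exact (cs.isRightDescent_iff_not_isRightDescent_mul.1 h) (descent_of_eta cs this)
  · exact h0

end cocycle

section products
open scoped Classical
variable {B : Type*} {M : CoxeterMatrix B} {W : Type*} [Group W] (cs : CoxeterSystem M W)

/-- Independent sets of the Coxeter graph. -/
def Indep (M : CoxeterMatrix B) (t : Finset B) : Prop := ∀ i ∈ t, ∀ j ∈ t, i ≠ j → M i j = 2

lemma Indep.mono {t u : Finset B} (h : Indep M t) (hu : u ⊆ t) : Indep M u :=
  fun i hi j hj hij => h i (hu hi) j (hu hj) hij

lemma Indep.comm {t : Finset B} (h : Indep M t) {i j : B} (hi : i ∈ t) (hj : j ∈ t) :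
    Commute (cs.simple i) (cs.simple j) := by
  by_cases hij : i = j
  · subst hij; exact Commute.refl _
  · exact commute_of_eq_two cs (h i hi j hj hij)

/-- The product of the simple reflections in a finite set. -/
noncomputable def pr (u : Finset B) : W := (u.toList.map cs.simple).prod

lemma pr_empty : pr cs ∅ = 1 := by simp [pr]

lemma Indep.comm_pr {t u : Finset B} (h : Indep M t) (hu : u ⊆ t) {i : B} (hi : i ∈ t) :
    Commute (cs.simple i) (pr cs u) := by
  apply Commute.list_prod_right
  intro x hx
  obtain ⟨j, hj, rfl⟩ := List.mem_map.1 hx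
  exact h.comm cs hi (hu (Finset.mem_toList.1 hj))

lemma pr_insert {u : Finset B} {i : B} (h : Indep M (insert i u)) (hi : i ∉ u) :
    pr cs (insert i u) = pr cs u * cs.simple i := by
  rw [← (h.comm_pr cs (Finset.subset_insert i u) (Finset.mem_insert_self i u)).eq]
  have hp := (Finset.toList_insert hi).map cs.simple
  rw [pr, hp.prod_eq' ?_]
  · simp [pr]
  · rw [List.pairwise_map]
    apply List.pairwise_of_forall_mem_list
    intro a ha b hb
    exact h.comm cs (Finset.mem_toList.1 ha) (Finset.mem_toList.1 hb)

lemma pr_union {t u u' : Finset B} (h : Indep M t) (hu : u ⊆ t) (hu' : u' ⊆ t)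
    (hd : Disjoint u u') : pr cs (u ∪ u') = pr cs u * pr cs u' := by
  induction u' using Finset.induction_on with
  | empty => simp [pr_empty]
  | insert i u' hi ih =>
    rw [Finset.disjoint_insert_right] at hd
    rw [Finset.insert_subset_iff] at hu'
    rw [Finset.union_insert, pr_insert cs (h.mono ?_) ?_, pr_insert cs (h.mono ?_) hi,
      ih hu'.2 hd.2, mul_assoc]
    · exact Finset.insert_subset hu'.1 hu'.2
    · exact Finset.insert_subset hu'.1 (Finset.union_subset hu hu'.2)
    · simp [hi, hd.1]

lemma pr_mul_self {u : Finset B} (h : Indep M u) : pr cs u * pr cs u = 1 := by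
  induction u using Finset.induction_on with
  | empty => simp [pr_empty]
  | insert i u hi ih =>
    have hs : u ⊆ insert i u := Finset.subset_insert i u
    rw [pr_insert cs h hi]
    have hc := (h.comm_pr cs hs (Finset.mem_insert_self i u)).eq
    calc pr cs u * cs.simple i * (pr cs u * cs.simple i)
        = pr cs u * (cs.simple i * pr cs u) * cs.simple i := by simp only [mul_assoc]
      _ = pr cs u * pr cs u * (cs.simple i * cs.simple i) := by rw [hc]; simp only [mul_assoc]
      _ = 1 := by rw [ih (h.mono hs), cs.simple_mul_simple_self, one_mul]

lemma pr_inv {u : Finset B} (h : Indep M u) : (pr cs u)⁻¹ = pr cs u :=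
  inv_eq_of_mul_eq_one_left (pr_mul_self cs h)

lemma eta_pr {t u : Finset B} (h : Indep M t) (hu : u ⊆ t) {i : B} (hi : i ∈ t) :
    eta cs (pr cs u) (cs.simple i) = if i ∈ u then 1 else 0 := by
  induction u using Finset.induction_on with
  | empty => simp [pr_empty, eta_one]
  | insert j u hj ih =>
    rw [Finset.insert_subset_iff] at hu
    rw [pr_insert cs (h.mono (Finset.insert_subset hu.1 hu.2)) hj, eta_mul, eta_simple,
      (h.comm cs hu.1 hi).eq, mul_inv_cancel_right, ih hu.2, (simple_inj cs).eq_iff]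
    by_cases hij : i = j
    · subst hij; simp [hj]
    · simp [hij]

lemma eta_mul_pr {t u : Finset B} (h : Indep M t) (hu : u ⊆ t) {i : B} (hi : i ∈ t) (v : W) :
    eta cs (v * pr cs u) (cs.simple i) = (if i ∈ u then 1 else 0) + eta cs v (cs.simple i) := by
  rw [eta_mul, eta_pr cs h hu hi, ← (h.comm_pr cs hu hi).eq, mul_inv_cancel_right]

lemma eta_zero_iff (w : W) (i : B) : eta cs w (cs.simple i) = 0 ↔ ¬ cs.IsRightDescent w i := by
  rw [← eta_iff]
  rcases zmod2 (eta cs w (cs.simple i)) with h | h <;> simp [h]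

lemma len_mul_pr {t u : Finset B} (h : Indep M t) (hu : u ⊆ t) {v : W}
    (hv : ∀ i ∈ t, ¬ cs.IsRightDescent v i) :
    cs.length (v * pr cs u) = cs.length v + u.card := by
  induction u using Finset.induction_on with
  | empty => simp [pr_empty]
  | insert j u hj ih =>
    rw [Finset.insert_subset_iff] at hu
    rw [pr_insert cs (h.mono (Finset.insert_subset hu.1 hu.2)) hj, ← mul_assoc]
    have : ¬ cs.IsRightDescent (v * pr cs u) j := by
      rw [← eta_zero_iff, eta_mul_pr cs h hu.2 hu.1, (eta_zero_iff cs v j).2 (hv j hu.1)]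
      simp [hj]
    rw [cs.not_isRightDescent_iff.1 this, ih hu.2, Finset.card_insert_of_notMem hj, add_assoc]

lemma len_pr {u : Finset B} (h : Indep M u) : cs.length (pr cs u) = u.card := by
  have := len_mul_pr cs h (le_refl u) (v := 1) (fun i _ => cs.not_isRightDescent_one i)
  simpa using this

lemma pr_support {u : Finset B} (h : Indep M u) {x : W} (hx : eta cs (pr cs u) x = 1) :
    ∃ j ∈ u, x = cs.simple j := by
  induction u using Finset.induction_on generalizing x with
  | empty => simp [pr_empty, eta_one] at hx
  | insert j u hj ih =>
    by_cases hxj : x = cs.simple j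
    · exact ⟨j, Finset.mem_insert_self _ _, hxj⟩
    rw [pr_insert cs h hj, eta_mul, eta_simple, if_neg hxj, zero_add] at hx
    obtain ⟨l, hl, hlx⟩ := ih (h.mono (Finset.subset_insert _ _)) hx
    refine ⟨l, Finset.mem_insert_of_mem hl, ?_⟩
    have hc := (h.comm cs (Finset.mem_insert_self j u) (Finset.mem_insert_of_mem hl)).eq
    rw [mul_inv_eq_iff_eq_mul, ← hc] at hlx
    exact mul_left_cancel hlx

lemma len_pr_mul_pr {t u u' : Finset B} (h : Indep M t) (hu : u ⊆ t) (hu' : u' ⊆ t) :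
    cs.length (pr cs u * pr cs u') = (u \ u').card + (u' \ u).card := by
  have h1 : u \ u' ⊆ t := Finset.sdiff_subset.trans hu
  have h2 : u' \ u ⊆ t := Finset.sdiff_subset.trans hu'
  have h3 : u ∩ u' ⊆ t := Finset.inter_subset_left.trans hu
  have e1 : pr cs u = pr cs (u \ u') * pr cs (u ∩ u') := by
    rw [← pr_union cs h h1 h3 (Finset.disjoint_sdiff_inter u u'), Finset.sdiff_union_inter]
  have e2 : pr cs u' = pr cs (u ∩ u') * pr cs (u' \ u) := by
    rw [← pr_union cs h h3 h2, Finset.inter_comm, Finset.union_comm, Finset.sdiff_union_inter]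
    rw [Finset.inter_comm]
    exact (Finset.disjoint_sdiff_inter u' u).symm
  have e3 : pr cs u * pr cs u' = pr cs (u \ u' ∪ u' \ u) := by
    rw [pr_union cs h h1 h2 disjoint_sdiff_sdiff, e1, e2, mul_assoc,
      ← mul_assoc (pr cs (u ∩ u')), pr_mul_self cs (h.mono h3), one_mul]
  rw [e3, len_pr cs (h.mono (Finset.union_subset h1 h2)),
    Finset.card_union_of_disjoint disjoint_sdiff_sdiff]

lemma below_pr {u : Finset B} (h : Indep M u) {y : W} (hy : weakLE cs y (pr cs u)) :
    ∃ u' ⊆ u, y = pr cs u' := by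
  induction u using Finset.strongInduction generalizing y with
  | H u ih =>
    by_cases hz : y⁻¹ * pr cs u = 1
    · exact ⟨u, le_refl _, (inv_mul_eq_one.1 hz)⟩
    obtain ⟨i, hi⟩ := cs.exists_rightDescent_of_ne_one hz
    unfold weakLE at hy
    have hi' := cs.isRightDescent_iff.1 hi
    have hb : cs.length (pr cs u * cs.simple i) ≤
        cs.length y + cs.length (y⁻¹ * pr cs u * cs.simple i) := by
      have := cs.length_mul_le y (y⁻¹ * pr cs u * cs.simple i)
      rwa [mul_assoc y⁻¹, mul_inv_cancel_left, ← mul_assoc y⁻¹] at this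
    have hd : cs.IsRightDescent (pr cs u) i := by
      unfold CoxeterSystem.IsRightDescent
      omega
    obtain ⟨j, hj, hij⟩ := pr_support cs h ((eta_iff cs _ _).2 hd)
    obtain rfl := simple_inj cs hij
    have he : pr cs u = pr cs (u.erase i) * cs.simple i := by
      rw [← pr_insert cs, Finset.insert_erase hj]
      · rwa [Finset.insert_erase hj]
      · exact Finset.notMem_erase i u
    have he' : pr cs u * cs.simple i = pr cs (u.erase i) := by
      rw [he, cs.simple_mul_simple_cancel_right]
    have hd' := cs.isRightDescent_iff.1 hd
    obtain ⟨u', hu', hy'⟩ := ih (u.erase i) (Finset.erase_ssubset hj)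
      (h.mono (Finset.erase_subset _ _)) (y := y) (by
        unfold weakLE
        rw [← he', ← mul_assoc]
        omega)
    exact ⟨u', hu'.trans (Finset.erase_subset _ _), hy'⟩

end products

section weak
open scoped Classical
variable {B : Type*} {M : CoxeterMatrix B} {W : Type*} [Group W] (cs : CoxeterSystem M W)

lemma weakLE_refl (a : W) : weakLE cs a a := by simp [weakLE]

lemma weakLE_trans {a b c : W} (h1 : weakLE cs a b) (h2 : weakLE cs b c) : weakLE cs a c := by
  unfold weakLE at *
  have h3 := cs.length_mul_le (a⁻¹ * b) (b⁻¹ * c)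
  have h4 := cs.length_mul_le a (a⁻¹ * c)
  rw [mul_assoc, mul_inv_cancel_left] at h3
  rw [mul_inv_cancel_left] at h4
  omega

lemma weakLE_antisymm {a b : W} (h1 : weakLE cs a b) (h2 : weakLE cs b a) : a = b := by
  unfold weakLE at *
  have : cs.length (a⁻¹ * b) = 0 := by omega
  exact inv_mul_eq_one.1 (cs.length_eq_zero_iff.1 this)

lemma weakLE_step {a b : W} (h : weakLE cs a b) (hne : a ≠ b) :
    ∃ i, ¬ cs.IsRightDescent a i ∧ weakLE cs a (a * cs.simple i) ∧
      weakLE cs (a * cs.simple i) b := by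
  have hz : a⁻¹ * b ≠ 1 := fun h => hne (inv_mul_eq_one.1 h)
  obtain ⟨i, hi⟩ := cs.exists_leftDescent_of_ne_one hz
  have hi' := cs.isLeftDescent_iff.1 hi
  unfold weakLE at *
  have h1 := cs.length_mul_le (a * cs.simple i) (cs.simple i * (a⁻¹ * b))
  have e : a * cs.simple i * (cs.simple i * (a⁻¹ * b)) = b := by
    rw [mul_assoc, cs.simple_mul_simple_cancel_left, mul_inv_cancel_left]
  rw [e] at h1
  have h2 := cs.length_mul_simple a i
  refine ⟨i, ?_, ?_, ?_⟩
  · rw [cs.not_isRightDescent_iff]; omega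
  · rw [inv_mul_cancel_left, cs.length_simple]; omega
  · rw [mul_inv_rev, cs.inv_simple, mul_assoc]; omega

lemma pair_aux {p q a b : B} (hpq : p ≠ q)
    (h : cs.simple p * cs.simple a = cs.simple q * cs.simple b)
    (h1 : cs.simple q * cs.simple b ≠ 1) : cs.simple a = cs.simple q := by
  have hbq : cs.simple b ≠ cs.simple q := by
    intro hb; rw [hb, cs.simple_mul_simple_self] at h1; exact h1 rfl
  have e1 : eta cs (cs.simple q * cs.simple b) (cs.simple b) = 1 := by
    rw [eta_mul, eta_simple, eta_simple]; simp [hbq]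
  have hab : cs.simple b ≠ cs.simple a := by
    intro hb
    rw [hb] at h
    exact hpq (simple_inj cs (mul_right_cancel h))
  rw [← h, eta_mul, eta_simple, eta_simple, if_neg hab, zero_add] at e1
  by_cases hc : cs.simple a * cs.simple b * (cs.simple a)⁻¹ = cs.simple p
  · rw [mul_inv_eq_iff_eq_mul, h] at hc
    exact mul_right_cancel hc
  · rw [if_neg hc] at e1; simp at e1

lemma boolean_of_indep {T : Finset B} (hT : Indep M T) {k : ℕ} (hk : T.card = k) {v : W}
    (hv : ∀ i ∈ T, ¬ cs.IsRightDescent v i) : IsBooleanInterval cs k v (v * pr cs T) := by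
  have key : ∀ u ⊆ T, ∀ u' ⊆ T, (weakLE cs (v * pr cs u) (v * pr cs u') ↔ u ⊆ u') := by
    intro u hu u' hu'
    unfold weakLE
    have e : (v * pr cs u)⁻¹ * (v * pr cs u') = pr cs u * pr cs u' := by
      rw [mul_inv_rev, pr_inv cs (hT.mono hu), mul_assoc, inv_mul_cancel_left]
    rw [e, len_mul_pr cs hT hu hv, len_mul_pr cs hT hu' hv, len_pr_mul_pr cs hT hu hu']
    have c1 := Finset.card_sdiff_add_card_inter u u'
    have c2 := Finset.card_sdiff_add_card_inter u' u
    rw [Finset.inter_comm] at c2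
    rw [← Finset.sdiff_eq_empty_iff_subset, ← Finset.card_eq_zero]
    omega
  have kv : ∀ u ⊆ T, weakLE cs v (v * pr cs u) := by
    intro u hu
    have := (key ∅ (Finset.empty_subset _) u hu).2 (Finset.empty_subset _)
    rwa [pr_empty, mul_one] at this
  refine ⟨kv T (le_refl _), ?_⟩
  let e := T.equivFinOfCardEq hk
  let emb : Fin k ↪ B := e.symm.toEmbedding.trans (Function.Embedding.subtype _)
  have hemb : ∀ A : Finset (Fin k), A.map emb ⊆ T := by
    intro A i hi
    obtain ⟨x, _, rfl⟩ := Finset.mem_map.1 hi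
    exact (e.symm x).2
  let g : Finset (Fin k) → {x : W // weakLE cs v x ∧ weakLE cs x (v * pr cs T)} := fun A =>
    ⟨v * pr cs (A.map emb), kv _ (hemb A), (key _ (hemb A) _ (le_refl _)).2 (hemb A)⟩
  have hg : ∀ A A', weakLE cs (g A).1 (g A').1 ↔ A ⊆ A' := by
    intro A A'
    rw [key _ (hemb A) _ (hemb A'), Finset.map_subset_map]
  have gi : Function.Injective g := by
    intro A A' h
    apply Finset.Subset.antisymm
    · rw [← hg, h]; exact weakLE_refl cs _
    · rw [← hg, h]; exact weakLE_refl cs _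
  have gs : Function.Surjective g := by
    rintro ⟨x, hx1, hx2⟩
    have hy : weakLE cs (v⁻¹ * x) (pr cs T) := by
      unfold weakLE at *
      rw [len_mul_pr cs hT (le_refl _) hv] at hx2
      rw [len_pr cs hT, mul_inv_rev, inv_inv, mul_assoc]
      omega
    obtain ⟨u, hu, hxu⟩ := below_pr cs hT hy
    refine ⟨Finset.univ.filter (fun x => emb x ∈ u), ?_⟩
    have : (Finset.univ.filter (fun x => emb x ∈ u)).map emb = u := by
      ext i
      simp only [Finset.mem_map, Finset.mem_filter, Finset.mem_univ, true_and]
      constructor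
      · rintro ⟨x, hx, rfl⟩; exact hx
      · intro hi
        have : emb (e ⟨i, hu hi⟩) = i := by simp [emb]
        exact ⟨e ⟨i, hu hi⟩, by rwa [this], this⟩
    apply Subtype.ext
    change v * pr cs _ = x
    rw [this, ← hxu, mul_inv_cancel_left]
  refine ⟨(Equiv.ofBijective g ⟨gi, gs⟩).symm, ?_⟩
  intro a b
  obtain ⟨A, rfl⟩ := gs a
  obtain ⟨A', rfl⟩ := gs b
  have hs : ∀ A, (Equiv.ofBijective g ⟨gi, gs⟩).symm (g A) = A := fun A =>
    (Equiv.ofBijective g ⟨gi, gs⟩).symm_apply_apply A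
  rw [hg, hs, hs]

lemma indep_of_boolean {k : ℕ} {v w : W} (h : IsBooleanInterval cs k v w) :
    ∃ T : Finset B, T.card = k ∧ Indep M T ∧ (∀ i ∈ T, ¬ cs.IsRightDescent v i) ∧
      w = v * pr cs T := by
  obtain ⟨hvw, f, hf⟩ := h
  let F : Finset (Fin k) → W := fun A => (f.symm A).1
  have hF : ∀ A A', weakLE cs (F A) (F A') ↔ A ⊆ A' := by
    intro A A'
    rw [hf, Equiv.apply_symm_apply, Equiv.apply_symm_apply]
  have hFs : ∀ x, weakLE cs v x → weakLE cs x w → ∃ A, F A = x := fun x h1 h2 =>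
    ⟨f ⟨x, h1, h2⟩, by simp [F]⟩
  have hF1 : ∀ A, weakLE cs v (F A) := fun A => (f.symm A).2.1
  have hF2 : ∀ A, weakLE cs (F A) w := fun A => (f.symm A).2.2
  have Fi : Function.Injective F := fun A A' h => f.symm.injective (Subtype.ext h)
  have F0 : F ∅ = v := by
    obtain ⟨A, hA⟩ := hFs v (weakLE_refl cs v) hvw
    refine weakLE_antisymm cs ?_ (hF1 _)
    rw [← hA, hF]; exact Finset.empty_subset _
  have Fu : F Finset.univ = w := by
    obtain ⟨A, hA⟩ := hFs w hvw (weakLE_refl cs w)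
    refine weakLE_antisymm cs (hF2 _) ?_
    rw [← hA, hF]; exact Finset.subset_univ _
  have cov : ∀ A x, x ∉ A → ∃ i, ¬ cs.IsRightDescent (F A) i ∧
      F (insert x A) = F A * cs.simple i := by
    intro A x hx
    obtain ⟨i, hi, h1, h2⟩ := weakLE_step cs ((hF A (insert x A)).2 (Finset.subset_insert _ _))
      (fun e => hx (by rw [Fi e]; exact Finset.mem_insert_self _ _))
    refine ⟨i, hi, ?_⟩
    obtain ⟨C, hC⟩ := hFs (F A * cs.simple i) (weakLE_trans cs (hF1 _) h1)
      (weakLE_trans cs h2 (hF2 _))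
    rw [← hC] at h1 h2 ⊢
    rw [hF] at h1 h2
    congr 1
    refine Finset.Subset.antisymm ?_ h2
    refine Finset.insert_subset ?_ h1
    by_contra hxC
    have : C = A := by
      refine Finset.Subset.antisymm (fun y hy => ?_) h1
      rcases Finset.mem_insert.1 (h2 hy) with rfl | h
      · exact absurd hy hxC
      · exact h
    rw [this] at hC
    have := cs.length_mul_simple_ne (F A) i
    rw [← hC] at this
    exact this rfl
  have rank : ∀ A, cs.length (F A) = cs.length v + A.card := by
    intro A
    induction A using Finset.induction_on with
    | empty => rw [F0]; simp
    | insert x A hx ih =>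
      obtain ⟨i, hi, e⟩ := cov A x hx
      rw [e, cs.not_isRightDescent_iff.1 hi, ih, Finset.card_insert_of_notMem hx, add_assoc]
  choose g hg1 hg2 using fun x => cov ∅ x (Finset.notMem_empty x)
  simp only [F0, insert_empty_eq] at hg1 hg2
  have gi : Function.Injective g := by
    intro x y hxy
    have : F {x} = F {y} := by rw [hg2, hg2, hxy]
    exact Finset.singleton_injective (Fi this)
  have hcomm : ∀ x y, x ≠ y →
      cs.simple (g x) * cs.simple (g y) = cs.simple (g y) * cs.simple (g x) := by
    intro x y hxy
    obtain ⟨a, ha, ea⟩ := cov {x} y (by simpa using hxy.symm)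
    obtain ⟨b, hb, eb⟩ := cov {y} x (by simpa using hxy)
    have hp : (insert y {x} : Finset (Fin k)) = insert x {y} := Finset.pair_comm y x
    have hr := rank (insert x {y})
    rw [Finset.card_pair hxy] at hr
    rw [hg2, mul_assoc] at ea eb
    have hne : cs.simple (g y) * cs.simple b ≠ 1 := by
      intro h1
      rw [eb, h1, mul_one] at hr
      omega
    rw [hp, eb] at ea
    have ea' := mul_left_cancel ea
    have r1 := pair_aux cs (fun e => hxy (gi e)) ea'.symm hne
    have r2 := pair_aux cs (fun e => hxy (gi e).symm) ea' (by rw [← ea']; exact hne)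
    rw [r1, r2] at ea'
    exact ea'.symm
  let T : Finset B := Finset.univ.image g
  have hTk : T.card = k := by
    rw [Finset.card_image_of_injective _ gi]; simp
  have hT : Indep M T := by
    intro i hi j hj hij
    obtain ⟨x, _, rfl⟩ := Finset.mem_image.1 hi
    obtain ⟨y, _, rfl⟩ := Finset.mem_image.1 hj
    exact eq_two_of_commute cs hij (hcomm x y (fun e => hij (by rw [e])))
  have hTv : ∀ i ∈ T, ¬ cs.IsRightDescent v i := by
    intro i hi
    obtain ⟨x, _, rfl⟩ := Finset.mem_image.1 hi
    exact hg1 x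
  refine ⟨T, hTk, hT, hTv, ?_⟩
  have hw : cs.length w = cs.length v + k := by
    rw [← Fu, rank]; simp
  have hz : cs.length (v⁻¹ * w) = k := by
    unfold weakLE at hvw; omega
  have hdes : ∀ i ∈ T, cs.IsRightDescent (v⁻¹ * w)⁻¹ i := by
    intro i hi
    obtain ⟨x, _, rfl⟩ := Finset.mem_image.1 hi
    rw [cs.isRightDescent_inv_iff, CoxeterSystem.IsLeftDescent]
    have h1 := hF2 {x}
    have h2 := rank {x}
    rw [hg2] at h1 h2
    unfold weakLE at h1
    rw [mul_inv_rev, cs.inv_simple, mul_assoc] at h1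
    simp only [Finset.card_singleton] at h2
    omega
  have hy : ∀ i ∈ T, ¬ cs.IsRightDescent ((v⁻¹ * w)⁻¹ * pr cs T) i := by
    intro i hi
    rw [← eta_zero_iff, eta_mul_pr cs hT (le_refl _) hi, (eta_iff cs _ _).2 (hdes i hi), if_pos hi]
    decide
  have hl := len_mul_pr cs hT (le_refl _) hy
  rw [mul_assoc, pr_mul_self cs hT, mul_one, cs.length_inv, hz, hTk] at hl
  have h0 : cs.length ((v⁻¹ * w)⁻¹ * pr cs T) = 0 := by omega
  have h1 := inv_mul_eq_one.1 (cs.length_eq_zero_iff.1 h0)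
  rw [← h1, mul_inv_cancel_left]

lemma card_min [Finite W] {T : Finset B} (hT : Indep M T) {k : ℕ} (hk : T.card = k) :
    Nat.card {v : W // ∀ i ∈ T, ¬ cs.IsRightDescent v i} * 2 ^ k = Nat.card W := by
  have hp : Nat.card {u // u ∈ T.powerset} = 2 ^ k := by
    rw [Nat.card_eq_fintype_card, Fintype.card_coe, Finset.card_powerset, hk]
  rw [← hp, ← Nat.card_prod]
  refine Nat.card_eq_of_bijective (fun p => p.1.1 * pr cs p.2.1) ⟨?_, ?_⟩
  · rintro ⟨⟨v, hv⟩, ⟨u, hu⟩⟩ ⟨⟨v', hv'⟩, ⟨u', hu'⟩⟩ h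
    simp only at h
    rw [Finset.mem_powerset] at hu hu'
    have key : ∀ v : W, (∀ i ∈ T, ¬ cs.IsRightDescent v i) → ∀ u ⊆ T, ∀ i ∈ T,
        (eta cs (v * pr cs u) (cs.simple i) = 1 ↔ i ∈ u) := by
      intro v hv u hu i hi
      rw [eta_mul_pr cs hT hu hi, (eta_zero_iff cs _ _).2 (hv i hi)]
      by_cases h : i ∈ u <;> simp [h]
    have huu : u = u' := by
      ext i
      by_cases hi : i ∈ T
      · rw [← key v hv u hu i hi, h, key v' hv' u' hu' i hi]
      · exact ⟨fun h => absurd (hu h) hi, fun h => absurd (hu' h) hi⟩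
    subst huu
    have := mul_right_cancel h
    subst this
    rfl
  · intro w
    let u := T.filter (fun i => cs.IsRightDescent w i)
    have hu : u ⊆ T := Finset.filter_subset _ _
    refine ⟨⟨⟨w * pr cs u, ?_⟩, ⟨u, Finset.mem_powerset.2 hu⟩⟩, ?_⟩
    · intro i hi
      rw [← eta_zero_iff, eta_mul_pr cs hT hu hi]
      by_cases hd : cs.IsRightDescent w i
      · rw [(eta_iff cs _ _).2 hd, if_pos (Finset.mem_filter.2 ⟨hi, hd⟩)]; decide
      · rw [(eta_zero_iff cs _ _).2 hd, if_neg (fun h => hd (Finset.mem_filter.1 h).2)]; decide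
    · simp only
      rw [mul_assoc, pr_mul_self cs (hT.mono hu), mul_one]

lemma main [Finite B] [Finite W] (k : ℕ) :
    Nat.card {p : W × W // IsBooleanInterval cs k p.1 p.2} * 2 ^ k =
      Nat.card {t : Finset B // t.card = k ∧ Indep M t} * Nat.card W := by
  have hc : Nat.card (Σ T : {t : Finset B // t.card = k ∧ Indep M t},
      {v : W // ∀ i ∈ T.1, ¬ cs.IsRightDescent v i}) =
      Nat.card {p : W × W // IsBooleanInterval cs k p.1 p.2} := by
    refine Nat.card_eq_of_bijective
      (fun p => ⟨(p.2.1, p.2.1 * pr cs p.1.1), boolean_of_indep cs p.1.2.2 p.1.2.1 p.2.2⟩) ⟨?_, ?_⟩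
    · rintro ⟨⟨T, hk, hT⟩, ⟨v, hv⟩⟩ ⟨⟨T', hk', hT'⟩, ⟨v', hv'⟩⟩ h
      simp only [Subtype.mk.injEq, Prod.mk.injEq] at h
      obtain ⟨rfl, h⟩ := h
      have h := mul_left_cancel h
      have sub : ∀ T T' : Finset B, Indep M T → Indep M T' → pr cs T = pr cs T' → T ⊆ T' := by
        intro T T' hT hT' h i hi
        have e := eta_pr cs hT (le_refl _) hi
        rw [if_pos hi, h] at e
        obtain ⟨j, hj, hij⟩ := pr_support cs hT' e
        rwa [simple_inj cs hij]
      obtain rfl := Finset.Subset.antisymm (sub T T' hT hT' h) (sub T' T hT' hT h.symm)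
      rfl
    · rintro ⟨⟨v, w⟩, h⟩
      obtain ⟨T, hk, hT, hv, hw⟩ := indep_of_boolean cs h
      refine ⟨⟨⟨T, hk, hT⟩, ⟨v, hv⟩⟩, ?_⟩
      apply Subtype.ext
      simp only
      rw [← hw]
  have := Fintype.ofFinite {t : Finset B // t.card = k ∧ Indep M t}
  rw [← hc, Nat.card_sigma, Finset.sum_mul, Finset.sum_congr rfl
    (fun T _ => card_min cs T.2.2 T.2.1), Finset.sum_const, Finset.card_univ,
    Nat.card_eq_fintype_card (α := {t : Finset B // t.card = k ∧ Indep M t}), smul_eq_mul]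

end weak
end BoolInt

/-- For a finite Coxeter group `W` with Coxeter graph `Γ_W` (vertices
`S`, with `s ≁ s'` iff `m(s, s') = 2`), the number of Boolean intervals of rank `k` in
the right weak order of `W` (counted by their pairs of endpoints) equals
`i_k(Γ_W) · |W| / 2^k`, where `i_k(Γ_W)` is the number of independent sets of size `k`
of `Γ_W`. -/
theorem card_booleanIntervals {B W : Type*} [Finite B] [Group W] [Finite W]
    {M : CoxeterMatrix B} (cs : CoxeterSystem M W) (k : ℕ) :
    Nat.card {p : W × W // IsBooleanInterval cs k p.1 p.2} =
      Nat.card {t : Finset B // t.card = k ∧ ∀ i ∈ t, ∀ j ∈ t, i ≠ j → M i j = 2} *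
        Nat.card W / 2 ^ k := by
  symm
  apply Nat.div_eq_of_eq_mul_left (by positivity)
  exact (BoolInt.main cs k).symm
end

section
/- For the symmetric group S_n (the Coxeter group of type A_{n-1}), the number of Boolean intervals of rank k in the right weak order equals (n!/2^k) · binomial(n-k, k). -/
open Equiv Finset



/-- adjacent transposition -/
def ssw {m : ℕ} (i : Fin m) : Perm (Fin (m + 1)) := Equiv.swap i.castSucc i.succ

/-- Inversion set, by values. -/
def NN {m : ℕ} (σ : Perm (Fin (m + 1))) : Finset (Fin (m + 1) × Fin (m + 1)) :=
  Finset.univ.filter (fun p => p.1 < p.2 ∧ σ⁻¹ p.2 < σ⁻¹ p.1)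

theorem mem_NN {m : ℕ} (σ : Perm (Fin (m + 1))) (p : Fin (m + 1) × Fin (m + 1)) :
    p ∈ NN σ ↔ p.1 < p.2 ∧ σ⁻¹ p.2 < σ⁻¹ p.1 := by simp [NN]

theorem mem_NN' {m : ℕ} (σ : Perm (Fin (m + 1))) (x y : Fin (m + 1)) :
    (σ x, σ y) ∈ NN σ ↔ σ x < σ y ∧ y < x := by simp [NN]

theorem ssw_inv {m : ℕ} (i : Fin m) : (ssw i)⁻¹ = ssw i := by simp [ssw]

theorem ssw_mul_self {m : ℕ} (i : Fin m) : ssw i * ssw i = 1 := by simp [ssw]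

theorem ssw_left {m : ℕ} (i : Fin m) : ssw i i.castSucc = i.succ := by simp [ssw]

theorem ssw_right {m : ℕ} (i : Fin m) : ssw i i.succ = i.castSucc := by simp [ssw]

theorem ssw_other {m : ℕ} (i : Fin m) (x : Fin (m + 1)) (h1 : x ≠ i.castSucc) (h2 : x ≠ i.succ) :
    ssw i x = x := by simp [ssw, Equiv.swap_apply_of_ne_of_ne h1 h2]

theorem ssw_lt {m : ℕ} (i : Fin m) (x y : Fin (m + 1)) (h1 : ¬ (x = i.castSucc ∧ y = i.succ))
    (h2 : ¬ (y = i.castSucc ∧ x = i.succ)) : ssw i y < ssw i x ↔ y < x := by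
  simp only [ssw, Equiv.swap_apply_def]
  simp only [Fin.ext_iff, Fin.lt_def, Fin.val_castSucc, Fin.val_succ] at *
  split_ifs <;> simp only [Fin.val_castSucc, Fin.val_succ] <;> omega

theorem inv_app {α : Type*} (σ : Perm α) (x : α) : σ⁻¹ (σ x) = x := by simp

theorem NN_mul {m : ℕ} (v : Perm (Fin (m + 1))) (i : Fin m) (h : v i.castSucc < v i.succ) :
    NN (v * ssw i) = insert (v i.castSucc, v i.succ) (NN v) := by
  ext ⟨a, b⟩
  obtain ⟨x, rfl⟩ := v.surjective a
  obtain ⟨y, rfl⟩ := v.surjective b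
  simp only [mem_NN, Finset.mem_insert, mul_inv_rev, ssw_inv, Perm.mul_apply, inv_app,
    Prod.mk.injEq, v.injective.eq_iff]
  by_cases h1 : x = i.castSucc ∧ y = i.succ
  · obtain ⟨rfl, rfl⟩ := h1
    simp [ssw_left, ssw_right, h]
  by_cases h2 : y = i.castSucc ∧ x = i.succ
  · obtain ⟨rfl, rfl⟩ := h2
    simp [h.not_gt, h1]
  rw [ssw_lt i x y h1 h2]
  simp [h1]

theorem NN_not_mem {m : ℕ} (v : Perm (Fin (m + 1))) (i : Fin m) :
    (v i.castSucc, v i.succ) ∉ NN v := by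
  rw [mem_NN']
  simp only [Fin.lt_def, Fin.val_castSucc, Fin.val_succ]; omega

theorem card_NN_mul {m : ℕ} (v : Perm (Fin (m + 1))) (i : Fin m) (h : v i.castSucc < v i.succ) :
    (NN (v * ssw i)).card = (NN v).card + 1 := by
  rw [NN_mul v i h, Finset.card_insert_of_notMem (NN_not_mem v i)]

theorem card_NN_mul_desc {m : ℕ} (v : Perm (Fin (m + 1))) (i : Fin m)
    (h : ¬ v i.castSucc < v i.succ) :
    (NN (v * ssw i)).card + 1 = (NN v).card := by
  have := card_NN_mul (v * ssw i) i (by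
    simp only [Perm.mul_apply, ssw_left, ssw_right]
    refine lt_of_le_of_ne (not_lt.mp h) ?_
    intro h'
    have := v.injective h'
    simp [Fin.ext_iff] at this)
  rw [← this, mul_assoc, ssw_mul_self, mul_one]

theorem NN_step {m : ℕ} (v x : Perm (Fin (m + 1))) (h : NN v ⊆ NN x) (hne : v ≠ x) :
    ∃ i : Fin m, v i.castSucc < v i.succ ∧ (v i.castSucc, v i.succ) ∈ NN x := by
  by_contra! hc
  apply hne
  have hm : StrictMono (x⁻¹ * v) := by
    rw [Fin.strictMono_iff_lt_succ]
    intro i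
    have hne' : (x⁻¹ * v) i.castSucc ≠ (x⁻¹ * v) i.succ := by
      intro h'
      have := (x⁻¹ * v).injective h'
      simp [Fin.ext_iff] at this
    by_cases hi : v i.castSucc < v i.succ
    · have := hc i hi
      rw [mem_NN] at this
      simp only [hi, true_and, not_lt] at this
      exact lt_of_le_of_ne this hne'
    · have h1 : v i.succ < v i.castSucc := lt_of_le_of_ne (not_lt.mp hi) (by
        intro h'
        have := v.injective h'
        simp [Fin.ext_iff] at this)
      have : (v i.succ, v i.castSucc) ∈ NN v := by
        rw [mem_NN']; exact ⟨h1, Fin.castSucc_lt_succ⟩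
      have := h this
      rw [mem_NN] at this
      exact this.2
  have h1 : (⇑(x⁻¹ * v)) = id := by
    exact StrictMono.eq_id hm
  have h2 : x⁻¹ * v = 1 := by ext a; simp [h1]
  rw [inv_mul_eq_one] at h2
  exact h2.symm

theorem NN_step' {m : ℕ} (v x : Perm (Fin (m + 1))) (h : NN v ⊆ NN x) (hne : v ≠ x) :
    ∃ i : Fin m, v i.castSucc < v i.succ ∧ NN (v * ssw i) ⊆ NN x := by
  obtain ⟨i, h1, h2⟩ := NN_step v x h hne
  refine ⟨i, h1, ?_⟩
  rw [NN_mul v i h1]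
  exact Finset.insert_subset h2 h

theorem NN_inj {m : ℕ} (v x : Perm (Fin (m + 1))) (h : NN v = NN x) : v = x := by
  by_contra hne
  obtain ⟨i, h1, h2⟩ := NN_step v x h.le hne
  rw [← h] at h2
  exact NN_not_mem v i h2

theorem NN_one {m : ℕ} : NN (1 : Perm (Fin (m + 1))) = ∅ := by
  ext ⟨a, b⟩
  rw [mem_NN]
  simp only [inv_one, Perm.one_apply, notMem_empty, iff_false, not_and, not_lt]
  exact le_of_lt


theorem A_self {m : ℕ} (i : Fin m) : (CoxeterMatrix.A m).M i i = 1 := by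
  simp [CoxeterMatrix.A]

theorem A_adj {m : ℕ} (i j : Fin m) (h : (i : ℕ) + 1 = j) : (CoxeterMatrix.A m).M i j = 3 := by
  have : i ≠ j := by rintro rfl; omega
  simp [CoxeterMatrix.A, this, h]

theorem A_comm {m : ℕ} (i j : Fin m) (h : (i : ℕ) + 1 < j) : (CoxeterMatrix.A m).M i j = 2 := by
  have : i ≠ j := by rintro rfl; omega
  have h2 : ¬ (((j : ℕ) + 1 = i) ∨ ((i : ℕ) + 1 = j)) := by omega
  simp [CoxeterMatrix.A, this, h2]

theorem ssw_comm {m : ℕ} (i j : Fin m) (h : (i : ℕ) + 1 < j) : ssw i * ssw j = ssw j * ssw i := by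
  conv_lhs => rw [ssw.eq_def j, Equiv.mul_swap_eq_swap_mul]
  rw [ssw_other, ssw_other, ← ssw.eq_def]
  all_goals (simp only [ne_eq, Fin.ext_iff, Fin.val_castSucc, Fin.val_succ]; omega)

theorem ssw_braid {m : ℕ} (i j : Fin m) (h : (i : ℕ) + 1 = j) :
    (ssw i * ssw j) ^ 3 = 1 := by
  have hj : j.castSucc = i.succ := by
    simp only [Fin.ext_iff, Fin.val_castSucc, Fin.val_succ]; omega
  have e1 : ssw i * ssw j = swap i.castSucc j.succ * ssw i := by
    conv_lhs => rw [ssw.eq_def j, Equiv.mul_swap_eq_swap_mul]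
    rw [hj, ssw_right, ssw_other]
    all_goals (simp only [ne_eq, Fin.ext_iff, Fin.val_castSucc, Fin.val_succ]; omega)
  have e2 : ssw j * ssw i = swap i.castSucc j.succ * ssw j := by
    conv_lhs => rw [ssw.eq_def i, Equiv.mul_swap_eq_swap_mul]
    rw [← hj, ssw_left, ssw_other]
    all_goals (simp only [ne_eq, Fin.ext_iff, Fin.val_castSucc, Fin.val_succ]; omega)
  calc (ssw i * ssw j) ^ 3 = (ssw i * ssw j) * ssw i * (ssw j * ssw i) * ssw j := by
        simp only [pow_succ, pow_zero, one_mul, mul_assoc]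
    _ = swap i.castSucc j.succ * (ssw i * ssw i) * (swap i.castSucc j.succ * ssw j) * ssw j := by
        rw [e1, e2]; simp only [mul_assoc]
    _ = (swap i.castSucc j.succ * swap i.castSucc j.succ) * (ssw j * ssw j) := by
        rw [ssw_mul_self]; simp only [mul_assoc, one_mul]
    _ = 1 := by rw [ssw_mul_self]; simp

theorem ssw_liftable (m : ℕ) : (CoxeterMatrix.A m).IsLiftable (ssw : Fin m → Perm (Fin (m + 1))) := by
  intro i j
  have inv1 : ∀ (k : ℕ), (ssw i * ssw j) ^ k = 1 → (ssw j * ssw i) ^ k = 1 := by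
    intro k hk
    have : ssw j * ssw i = (ssw i * ssw j)⁻¹ := by rw [mul_inv_rev, ssw_inv, ssw_inv]
    rw [this, inv_pow, hk, inv_one]
  have comm2 : ∀ i j : Fin m, (i : ℕ) + 1 < j → (ssw i * ssw j) ^ 2 = 1 := by
    intro i j h
    rw [pow_two]
    nth_rw 1 [ssw_comm i j h]
    rw [mul_assoc, ← mul_assoc (ssw i), ssw_mul_self, one_mul, ssw_mul_self]
  have key : ∀ i j : Fin m, (i : ℕ) < j → (ssw i * ssw j) ^ ((CoxeterMatrix.A m).M i j) = 1 := by
    intro i j h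
    rcases Nat.lt_or_ge (i + 1) j with h1 | h1
    · rw [A_comm i j h1]; exact comm2 i j h1
    · rw [A_adj i j (by omega)]; exact ssw_braid i j (by omega)
  rcases lt_trichotomy (i : ℕ) j with h | h | h
  · exact key i j h
  · obtain rfl : i = j := Fin.ext h
    show (ssw i * ssw i) ^ ((CoxeterMatrix.A m).M i i) = 1
    rw [A_self, ssw_mul_self, one_pow]
  · have := key j i h
    show (ssw i * ssw j) ^ ((CoxeterMatrix.A m).M i j) = 1
    have hs : (CoxeterMatrix.A m).M i j = (CoxeterMatrix.A m).M j i := (CoxeterMatrix.A m).symmetric i j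
    rw [hs]
    have e : ssw i * ssw j = (ssw j * ssw i)⁻¹ := by rw [mul_inv_rev, ssw_inv, ssw_inv]
    rw [e, inv_pow, this, inv_one]

section
variable {W : Type*} [Group W] {m : ℕ} (cs : CoxeterSystem (CoxeterMatrix.A m) W)

/-- The map to the symmetric group. -/
noncomputable def phi : W →* Perm (Fin (m + 1)) := cs.lift ⟨ssw, ssw_liftable m⟩

theorem phi_simple (i : Fin m) : phi cs (cs.simple i) = ssw i := cs.lift_apply_simple _ i

theorem phi_surj : Function.Surjective (phi cs) := by
  rw [← MonoidHom.mrange_eq_top, eq_top_iff, ← Equiv.Perm.mclosure_swap_castSucc_succ m,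
    Submonoid.closure_le]
  rintro _ ⟨i, rfl⟩
  exact ⟨cs.simple i, phi_simple cs i⟩

/-- Simple reflections indexed by naturals. -/
noncomputable def sn (i : ℕ) : W := if h : i < m then cs.simple ⟨i, h⟩ else 1

theorem sn_sq (i : ℕ) : sn cs i * sn cs i = 1 := by
  unfold sn; split_ifs <;> simp

theorem sn_comm (i j : ℕ) (h : i + 1 < j) : sn cs i * sn cs j = sn cs j * sn cs i := by
  unfold sn
  split_ifs with h1 h2
  · have := cs.simple_mul_simple_pow ⟨i, h1⟩ ⟨j, h2⟩
    have e : (CoxeterMatrix.A m).M ⟨i, h1⟩ ⟨j, h2⟩ = 2 := A_comm _ _ h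
    change _ ^ ((CoxeterMatrix.A m).M ⟨i, h1⟩ ⟨j, h2⟩) = 1 at this
    rw [e, pow_two, mul_eq_one_iff_eq_inv, mul_inv_rev] at this
    simpa using this
  all_goals simp

theorem sn_braid (i : ℕ) (h : i + 1 < m) :
    sn cs (i + 1) * sn cs i * sn cs (i + 1) = sn cs i * sn cs (i + 1) * sn cs i := by
  unfold sn
  rw [dif_pos h, dif_pos (by omega)]
  have := cs.simple_mul_simple_pow ⟨i, by omega⟩ ⟨i + 1, h⟩
  have e : (CoxeterMatrix.A m).M ⟨i, by omega⟩ ⟨i + 1, h⟩ = 3 := A_adj _ _ rfl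
  change _ ^ ((CoxeterMatrix.A m).M ⟨i, by omega⟩ ⟨i + 1, h⟩) = 1 at this
  rw [e] at this
  have h3 := congrArg (fun x => x * cs.simple ⟨i + 1, h⟩ * cs.simple ⟨i, by omega⟩ *
    cs.simple ⟨i + 1, h⟩) this
  simp only [pow_succ, pow_zero, one_mul, ← mul_assoc,
    CoxeterSystem.simple_mul_simple_cancel_right] at h3
  exact h3.symm

/-- `s_{j+t-1} ... s_j` -/
noncomputable def cc (j : ℕ) : ℕ → W
  | 0 => 1
  | t + 1 => sn cs (j + t) * cc j t

theorem cc_right (j t : ℕ) : cc cs (j + 1) t * sn cs j = cc cs j (t + 1) := by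
  induction t with
  | zero => simp [cc]
  | succ t ih =>
    rw [cc, mul_assoc, ih, cc.eq_2 cs j (t + 1)]
    congr 2; omega

theorem cc_comm_lt (i j t : ℕ) (h : i + 1 < j) : cc cs j t * sn cs i = sn cs i * cc cs j t := by
  induction t with
  | zero => simp [cc]
  | succ t ih => rw [cc, mul_assoc, ih, ← mul_assoc, ← sn_comm cs i (j + t) (by omega), mul_assoc]

theorem cc_comm_gt (i j t : ℕ) (h : j + t < i) : cc cs j t * sn cs i = sn cs i * cc cs j t := by
  induction t with
  | zero => simp [cc]
  | succ t ih =>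
    rw [cc, mul_assoc, ih (by omega), ← mul_assoc, sn_comm cs (j + t) i (by omega), mul_assoc]

theorem cc_mid (i j t : ℕ) (h : j < i + 1) (h2 : i + 1 < j + t) (h3 : i + 1 < m) :
    cc cs j t * sn cs (i + 1) = sn cs i * cc cs j t := by
  induction t with
  | zero => omega
  | succ t ih =>
    rcases Nat.lt_or_ge (i + 1) (j + t) with h4 | h4
    · rw [cc, mul_assoc, ih h4, ← mul_assoc, ← sn_comm cs i (j + t) (by omega), mul_assoc]
    · obtain ⟨u, rfl⟩ : ∃ u, t = u + 1 := ⟨t - 1, by omega⟩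
      have e1 : j + (u + 1) = i + 1 := by omega
      have e2 : j + u = i := by omega
      rw [cc, cc, e1, e2]
      calc sn cs (i + 1) * (sn cs i * cc cs j u) * sn cs (i + 1)
          = sn cs (i + 1) * sn cs i * (cc cs j u * sn cs (i + 1)) := by simp only [mul_assoc]
        _ = (sn cs (i + 1) * sn cs i * sn cs (i + 1)) * cc cs j u := by
            rw [cc_comm_gt cs (i + 1) j u (by omega)]; simp only [mul_assoc]
        _ = _ := by rw [sn_braid cs i h3]; simp only [mul_assoc]

/-- parabolic subgroup -/
def HH (r : ℕ) : Subgroup W := Subgroup.closure {x | ∃ i, i < r ∧ x = sn cs i}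

theorem HH_gen (i r : ℕ) (h : i < r) : sn cs i ∈ HH cs r :=
  Subgroup.subset_closure ⟨i, h, rfl⟩

theorem HH_decomp (r : ℕ) (hr : r < m) (w : W) (hw : w ∈ HH cs (r + 1)) :
    ∃ h ∈ HH cs r, ∃ j t, j + t = r + 1 ∧ w = h * cc cs j t := by
  have step : ∀ x : W, (∃ h ∈ HH cs r, ∃ j t, j + t = r + 1 ∧ x = h * cc cs j t) →
      ∀ i, i < r + 1 → ∃ h ∈ HH cs r, ∃ j t, j + t = r + 1 ∧ x * sn cs i = h * cc cs j t := by
    rintro _ ⟨h, hh, j, t, hjt, rfl⟩ i hi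
    rcases Nat.lt_or_ge (i + 1) j with h1 | h1
    · refine ⟨h * sn cs i, mul_mem hh (HH_gen cs i r (by omega)), j, t, hjt, ?_⟩
      rw [mul_assoc, cc_comm_lt cs i j t h1, mul_assoc]
    rcases Nat.eq_or_lt_of_le h1 with rfl | h1
    · refine ⟨h, hh, i, t + 1, by omega, ?_⟩
      rw [mul_assoc, cc_right]
    rcases Nat.eq_or_lt_of_le (Nat.lt_succ_iff.mp h1) with rfl | h1
    · obtain ⟨u, rfl⟩ : ∃ u, t = u + 1 := ⟨t - 1, by omega⟩
      refine ⟨h, hh, j + 1, u, by omega, ?_⟩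
      rw [← cc_right, mul_assoc, mul_assoc, sn_sq, mul_one]
    · obtain ⟨i, rfl⟩ : ∃ u, i = u + 1 := ⟨i - 1, by omega⟩
      refine ⟨h * sn cs i, mul_mem hh (HH_gen cs i r (by omega)), j, t, hjt, ?_⟩
      rw [mul_assoc, cc_mid cs i j t (by omega) (by omega) (by omega), mul_assoc]
  unfold HH at hw
  induction hw using Subgroup.closure_induction_right with
  | one => exact ⟨1, one_mem _, r + 1, 0, rfl, by simp [cc]⟩
  | mul_right x hx y hy ih =>
    obtain ⟨i, hi, rfl⟩ := hy
    exact step x ih i hi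
  | mul_inv_cancel x hx y hy ih =>
    obtain ⟨i, hi, rfl⟩ := hy
    rw [inv_eq_of_mul_eq_one_right (sn_sq cs i)]
    exact step x ih i hi

theorem phi_HH (r : ℕ) (h : W) (hh : h ∈ HH cs r) (x : Fin (m + 1)) (hx : r < x) :
    phi cs h x = x := by
  have key : HH cs r ≤ (MulAction.stabilizer (Perm (Fin (m + 1))) x).comap (phi cs) := by
    unfold HH
    rw [Subgroup.closure_le]
    rintro _ ⟨i, hi, rfl⟩
    simp only [Subgroup.coe_comap, Set.mem_preimage, SetLike.mem_coe, MulAction.mem_stabilizer_iff,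
      Perm.smul_def]
    unfold sn
    split_ifs with h1
    · rw [phi_simple, ssw_other] <;> simp [Fin.ext_iff] <;> omega
    · simp
  have := key hh
  simpa using this

theorem phi_cc (j t : ℕ) (x : Fin (m + 1)) (hx : (x : ℕ) = j) (h : j + t ≤ m) :
    (phi cs (cc cs j t) x : ℕ) = j + t := by
  induction t with
  | zero => simp [cc, hx]
  | succ t ih =>
    have := ih (by omega)
    rw [cc, map_mul, Perm.mul_apply]
    have e : phi cs (cc cs j t) x = (⟨j + t, by omega⟩ : Fin m).castSucc := Fin.ext this
    rw [e]
    unfold sn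
    rw [dif_pos (by omega), phi_simple, ssw_left]
    simp; omega

theorem phi_inj_aux (r : ℕ) (hr : r ≤ m) : ∀ w ∈ HH cs r, phi cs w = 1 → w = 1 := by
  induction r with
  | zero =>
    intro w hw _
    simpa [HH] using hw
  | succ r ih =>
    intro w hw h1
    obtain ⟨h, hh, j, t, hjt, rfl⟩ := HH_decomp cs r hr w hw
    have e := phi_cc cs j t ⟨j, by omega⟩ rfl (by omega)
    have e2 : phi cs (cc cs j t) ⟨j, by omega⟩ = ⟨r + 1, by omega⟩ := Fin.ext (by rw [e, hjt])
    have e3 := phi_HH cs r h hh ⟨r + 1, by omega⟩ (by simp)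
    have e4 : phi cs (h * cc cs j t) ⟨j, by omega⟩ = ⟨r + 1, by omega⟩ := by
      rw [map_mul, Perm.mul_apply, e2, e3]
    rw [h1] at e4
    simp only [Perm.one_apply, Fin.mk.injEq] at e4
    obtain rfl : t = 0 := by omega
    simp only [cc, mul_one] at h1 ⊢
    exact ih (by omega) h hh h1

theorem phi_inj : Function.Injective (phi cs) := by
  rw [injective_iff_map_eq_one]
  intro w
  refine phi_inj_aux cs m le_rfl w ?_
  have : HH cs m = ⊤ := by
    rw [eq_top_iff, ← cs.subgroup_closure_range_simple, Subgroup.closure_le]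
    rintro _ ⟨i, rfl⟩
    have := HH_gen cs i m i.2
    simpa [sn] using this
  rw [this]; trivial

theorem card_NN_le (w : W) : (NN (phi cs w)).card ≤ cs.length w := by
  obtain ⟨ω, h, rfl⟩ := cs.exists_isReduced w
  rw [h.eq]
  clear h
  induction ω using List.reverseRecOn with
  | nil => simp [NN_one]
  | append_singleton l i ih =>
    rw [cs.wordProd_append, cs.wordProd_singleton, map_mul, phi_simple, List.length_append,
      List.length_singleton]
    by_cases h : phi cs (cs.wordProd l) i.castSucc < phi cs (cs.wordProd l) i.succ
    · rw [card_NN_mul _ _ h]; omega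
    · have := card_NN_mul_desc _ _ h; omega

theorem length_le_of_NN (d : ℕ) : ∀ (v x : W), NN (phi cs v) ⊆ NN (phi cs x) →
    (NN (phi cs x)).card ≤ (NN (phi cs v)).card + d →
    cs.length (v⁻¹ * x) + (NN (phi cs v)).card ≤ (NN (phi cs x)).card := by
  induction d with
  | zero =>
    intro v x h hd
    have := NN_inj _ _ (Finset.eq_of_subset_of_card_le h hd)
    rw [phi_inj cs this]; simp
  | succ d ih =>
    intro v x h hd
    by_cases hvx : v = x
    · rw [hvx]; simp
    obtain ⟨i, hi, hs⟩ := NN_step' (phi cs v) (phi cs x) h (fun e => hvx (phi_inj cs e))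
    have hc := card_NN_mul _ _ hi
    rw [← phi_simple cs, ← map_mul] at hs hc
    have := ih (v * cs.simple i) x hs (by omega)
    rw [hc] at this
    have h2 : v⁻¹ * x = cs.simple i * ((v * cs.simple i)⁻¹ * x) := by
      simp [mul_assoc]
    have h3 := cs.length_mul_le (cs.simple i) ((v * cs.simple i)⁻¹ * x)
    rw [← h2, cs.length_simple] at h3
    omega

theorem length_eq_NN (w : W) : cs.length w = (NN (phi cs w)).card := by
  refine le_antisymm ?_ (card_NN_le cs w)
  have := length_le_of_NN cs (NN (phi cs w)).card 1 w (by simp [NN_one]) (by simp)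
  simpa [NN_one] using this

theorem weakLE_iff_NN (v x : W) : cs.length v + cs.length (v⁻¹ * x) = cs.length x ↔
    NN (phi cs v) ⊆ NN (phi cs x) := by
  constructor
  · intro h
    obtain ⟨y, rfl⟩ : ∃ y, x = v * y := ⟨v⁻¹ * x, by simp⟩
    rw [inv_mul_cancel_left] at h
    obtain ⟨ω, hω, rfl⟩ := cs.exists_isReduced y
    rw [hω.eq] at h
    clear hω
    induction ω using List.reverseRecOn with
    | nil => simp
    | append_singleton l i ih =>
      rw [cs.wordProd_append, cs.wordProd_singleton, List.length_append, List.length_singleton,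
        ← mul_assoc] at *
      have h1 := cs.length_mul_le v (cs.wordProd l)
      have h2 := cs.length_wordProd_le l
      have h3 := cs.length_mul_simple (v * cs.wordProd l) i
      have h4 := ih (by omega)
      refine h4.trans ?_
      have h5 : cs.length (v * cs.wordProd l * cs.simple i) = cs.length (v * cs.wordProd l) + 1 := by
        omega
      rw [length_eq_NN, length_eq_NN] at h5
      rw [map_mul _ (v * _), phi_simple] at h5 ⊢
      by_cases h : phi cs (v * cs.wordProd l) i.castSucc < phi cs (v * cs.wordProd l) i.succ
      · rw [NN_mul _ _ h]; exact Finset.subset_insert _ _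
      · have := card_NN_mul_desc _ _ h; omega
  · intro h
    have h1 := length_le_of_NN cs _ v x h (Nat.le_add_left _ _)
    have h2 := cs.length_mul_le v (v⁻¹ * x)
    rw [mul_inv_cancel_left] at h2
    rw [← length_eq_NN, ← length_eq_NN] at h1
    omega

end


/-- Boolean intervals among permutations. -/
def IsB {m : ℕ} (k : ℕ) (v w : Perm (Fin (m + 1))) : Prop :=
  NN v ⊆ NN w ∧ ∃ f : {x : Perm (Fin (m + 1)) // NN v ⊆ NN x ∧ NN x ⊆ NN w} ≃ Finset (Fin k),
    ∀ a b, NN a.1 ⊆ NN b.1 ↔ f a ⊆ f b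

/-- No two consecutive elements. -/
def Indep {m : ℕ} (J : Finset (Fin m)) : Prop := ∀ i ∈ J, ∀ j ∈ J, (i : ℕ) + 1 ≠ j

/-- All positions in `J` are ascents. -/
def Good {m : ℕ} (v : Perm (Fin (m + 1))) (J : Finset (Fin m)) : Prop :=
  ∀ i ∈ J, v i.castSucc < v i.succ

/-- The pair of values at position `i`. -/
def pr {m : ℕ} (v : Perm (Fin (m + 1))) (i : Fin m) : Fin (m + 1) × Fin (m + 1) :=
  (v i.castSucc, v i.succ)

/-- The pairs of values at the positions in `J`. -/
def VJ {m : ℕ} (v : Perm (Fin (m + 1))) (J : Finset (Fin m)) : Finset (Fin (m + 1) × Fin (m + 1)) :=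
  J.image (pr v)

theorem pr_inj {m : ℕ} (v : Perm (Fin (m + 1))) : Function.Injective (pr v) := by
  intro i j h
  have := v.injective (congrArg Prod.fst h)
  exact Fin.castSucc_injective _ this

theorem pr_mem_VJ {m : ℕ} (v : Perm (Fin (m + 1))) (i : Fin m) (J : Finset (Fin m)) :
    pr v i ∈ VJ v J ↔ i ∈ J := by
  simp [VJ, (pr_inj v).eq_iff]

theorem pr_notMem {m : ℕ} (v : Perm (Fin (m + 1))) (i : Fin m) : pr v i ∉ NN v := NN_not_mem v i

theorem Indep.mono {m : ℕ} {J K : Finset (Fin m)} (h : Indep J) (hK : K ⊆ J) : Indep K :=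
  fun i hi j hj => h i (hK hi) j (hK hj)

theorem Good.mono {m : ℕ} {v : Perm (Fin (m + 1))} {J K : Finset (Fin m)} (h : Good v J)
    (hK : K ⊆ J) : Good v K :=
  fun i hi => h i (hK hi)

theorem Indep.sep {m : ℕ} {J : Finset (Fin m)} {j : Fin m} (hj : j ∉ J)
    (h : Indep (insert j J)) (i : Fin m) (hi : i ∈ J) :
    (i.castSucc ≠ j.castSucc ∧ i.castSucc ≠ j.succ) ∧ (i.succ ≠ j.castSucc ∧ i.succ ≠ j.succ) := by
  have h1 := h i (Finset.mem_insert_of_mem hi) j (Finset.mem_insert_self _ _)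
  have h2 := h j (Finset.mem_insert_self _ _) i (Finset.mem_insert_of_mem hi)
  have h3 : (i : ℕ) ≠ j := fun e => hj (Fin.ext e ▸ hi)
  simp only [ne_eq, Fin.ext_iff, Fin.val_castSucc, Fin.val_succ]
  omega

theorem exists_top {m : ℕ} (v : Perm (Fin (m + 1))) (J : Finset (Fin m)) :
    Indep J → Good v J → ∃ w, NN w = NN v ∪ VJ v J ∧
      ∀ x, (∀ i ∈ J, x ≠ i.castSucc ∧ x ≠ i.succ) → w x = v x := by
  induction J using Finset.induction_on with
  | empty => intro _ _; exact ⟨v, by simp [VJ], fun _ _ => rfl⟩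
  | insert j J hj ih =>
    intro hI hG
    obtain ⟨w, hw, hx⟩ := ih (hI.mono (Finset.subset_insert _ _)) (hG.mono (Finset.subset_insert _ _))
    have e1 : w j.castSucc = v j.castSucc :=
      hx _ (fun i hi => ⟨(hI.sep hj i hi).1.1.symm, (hI.sep hj i hi).2.1.symm⟩)
    have e2 : w j.succ = v j.succ :=
      hx _ (fun i hi => ⟨(hI.sep hj i hi).1.2.symm, (hI.sep hj i hi).2.2.symm⟩)
    have hg := hG j (Finset.mem_insert_self _ _)
    refine ⟨w * ssw j, ?_, ?_⟩
    · rw [NN_mul _ _ (by rw [e1, e2]; exact hg), hw, e1, e2, VJ, VJ, Finset.image_insert,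
        Finset.union_insert]
      rfl
    · intro x h
      have h1 := h j (Finset.mem_insert_self _ _)
      rw [Perm.mul_apply, ssw_other _ _ h1.1 h1.2]
      exact hx x (fun i hi => h i (Finset.mem_insert_of_mem hi))

theorem subset_iff_aux {m : ℕ} (v : Perm (Fin (m + 1))) (J K : Finset (Fin m)) :
    NN v ∪ VJ v J ⊆ NN v ∪ VJ v K ↔ J ⊆ K := by
  constructor
  · intro h i hi
    have := h (Finset.mem_union_right _ ((pr_mem_VJ v i J).2 hi))
    rcases Finset.mem_union.1 this with h1 | h1
    · exact absurd h1 (pr_notMem v i)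
    · exact (pr_mem_VJ v i K).1 h1
  · intro h
    exact Finset.union_subset_union le_rfl (Finset.image_subset_image h)

theorem isB_of {m : ℕ} (v w : Perm (Fin (m + 1))) (J : Finset (Fin m)) (hI : Indep J)
    (hG : Good v J) (hw : NN w = NN v ∪ VJ v J) : IsB J.card v w := by
  refine ⟨by rw [hw]; exact Finset.subset_union_left, ?_⟩
  obtain ⟨e, he⟩ : ∃ e : Fin J.card ↪ Fin m, ∀ i, i ∈ J ↔ ∃ a, e a = i := by
    refine ⟨(J.orderEmbOfFin rfl).toEmbedding, fun i => ?_⟩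
    have := Finset.range_orderEmbOfFin J rfl
    have h2 : i ∈ Set.range (J.orderEmbOfFin rfl) ↔ i ∈ J := by rw [this]; simp
    rw [← h2]; rfl
  have hsub : ∀ S : Finset (Fin J.card), S.map e ⊆ J := by
    intro S i hi
    obtain ⟨a, _, rfl⟩ := Finset.mem_map.1 hi
    exact (he _).2 ⟨a, rfl⟩
  have hex : ∀ S : Finset (Fin J.card), ∃ x, NN x = NN v ∪ VJ v (S.map e) := by
    intro S
    obtain ⟨x, hx, _⟩ := exists_top v (S.map e) (hI.mono (hsub S)) (hG.mono (hsub S))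
    exact ⟨x, hx⟩
  choose F hF using hex
  let G : Finset (Fin J.card) → {x : Perm (Fin (m + 1)) // NN v ⊆ NN x ∧ NN x ⊆ NN w} :=
    fun S => ⟨F S, by rw [hF]; exact Finset.subset_union_left, by
      rw [hF, hw, subset_iff_aux]; exact hsub S⟩
  have hG' : ∀ S T, NN (G S).1 ⊆ NN (G T).1 ↔ S ⊆ T := by
    intro S T
    show NN (F S) ⊆ NN (F T) ↔ _
    rw [hF, hF, subset_iff_aux, Finset.map_subset_map]
  have hbij : Function.Bijective G := by
    constructor
    · intro S T h
      exact Finset.Subset.antisymm ((hG' S T).1 (by rw [h])) ((hG' T S).1 (by rw [h]))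
    · rintro ⟨x, h1, h2⟩
      classical
      refine ⟨Finset.univ.filter (fun a => pr v (e a) ∈ NN x), Subtype.ext (NN_inj _ _ ?_)⟩
      show NN (F _) = NN x
      rw [hF]
      apply Finset.Subset.antisymm
      · apply Finset.union_subset h1
        intro p hp
        simp only [VJ, Finset.mem_image, Finset.mem_map, Finset.mem_filter] at hp
        obtain ⟨_, ⟨a, ⟨_, ha⟩, rfl⟩, rfl⟩ := hp
        exact ha
      · intro p hp
        have := h2 hp
        rw [hw] at this
        rcases Finset.mem_union.1 this with h3 | h3
        · exact Finset.mem_union_left _ h3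
        · obtain ⟨i, hi, rfl⟩ := Finset.mem_image.1 h3
          obtain ⟨a, rfl⟩ := (he i).1 hi
          apply Finset.mem_union_right
          rw [pr_mem_VJ]
          exact Finset.mem_map_of_mem _ (by simp [hp])
  refine ⟨(Equiv.ofBijective G hbij).symm, ?_⟩
  intro a b
  obtain ⟨S, rfl⟩ := (Equiv.ofBijective G hbij).surjective a
  obtain ⟨T, rfl⟩ := (Equiv.ofBijective G hbij).surjective b
  rw [Equiv.symm_apply_apply, Equiv.symm_apply_apply]
  exact hG' S T

theorem of_isB {m : ℕ} (k : ℕ) (v w : Perm (Fin (m + 1))) (h : IsB k v w) :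
    ∃ J : Finset (Fin m), Indep J ∧ Good v J ∧ J.card = k ∧ NN w = NN v ∪ VJ v J := by
  obtain ⟨hvw, f, hf⟩ := h
  let v' : {x : Perm (Fin (m + 1)) // NN v ⊆ NN x ∧ NN x ⊆ NN w} := ⟨v, le_rfl, hvw⟩
  let w' : {x : Perm (Fin (m + 1)) // NN v ⊆ NN x ∧ NN x ⊆ NN w} := ⟨w, hvw, le_rfl⟩
  have hfv : f v' = ∅ := by
    have := (hf v' (f.symm ∅)).1 (f.symm ∅).2.1
    rw [f.apply_symm_apply] at this
    exact Finset.subset_empty.1 this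
  have atom : ∀ a : Fin k, ∃ j : Fin m, v j.castSucc < v j.succ ∧
      (f.symm {a}).1 = v * ssw j := by
    intro a
    have hne : v ≠ (f.symm {a}).1 := by
      intro h
      have h2 : v' = f.symm {a} := Subtype.ext h
      rw [h2, f.apply_symm_apply] at hfv
      simp at hfv
    obtain ⟨j, h1, h2⟩ := NN_step' v _ (f.symm {a}).2.1 hne
    refine ⟨j, h1, ?_⟩
    let y : {x : Perm (Fin (m + 1)) // NN v ⊆ NN x ∧ NN x ⊆ NN w} :=
      ⟨v * ssw j, by rw [NN_mul _ _ h1]; exact Finset.subset_insert _ _,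
        h2.trans (f.symm {a}).2.2⟩
    have h3 := (hf y (f.symm {a})).1 h2
    rw [f.apply_symm_apply, Finset.subset_singleton_iff] at h3
    rcases h3 with h3 | h3
    · exfalso
      have h4 : y = v' := f.injective (h3.trans hfv.symm)
      have h5 : NN (v * ssw j) = NN v := congrArg (fun z => NN z.1) h4
      rw [NN_mul _ _ h1] at h5
      exact NN_not_mem v j (h5 ▸ Finset.mem_insert_self _ _)
    · rw [← h3, f.symm_apply_apply]
  choose j hj1 hj2 using atom
  have hN : ∀ a, NN (f.symm {a}).1 = insert (pr v (j a)) (NN v) := by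
    intro a; rw [hj2, NN_mul _ _ (hj1 a)]; rfl
  have hinj : Function.Injective j := by
    intro a b hab
    have : f.symm {a} = f.symm {b} := Subtype.ext (by rw [hj2, hj2, hab])
    simpa using f.symm.injective this
  have hmem : ∀ (a : Fin k) (x : {x : Perm (Fin (m + 1)) // NN v ⊆ NN x ∧ NN x ⊆ NN w}),
      a ∈ f x ↔ pr v (j a) ∈ NN x.1 := by
    intro a x
    have h1 := hf (f.symm {a}) x
    rw [f.apply_symm_apply, Finset.singleton_subset_iff, hN] at h1
    rw [← h1]
    exact ⟨fun h => h (Finset.mem_insert_self _ _), fun h => Finset.insert_subset h x.2.1⟩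
  have hGood : Good v (Finset.univ.image j) := by
    intro i hi
    obtain ⟨a, _, rfl⟩ := Finset.mem_image.1 hi
    exact hj1 a
  have hInd : Indep (Finset.univ.image j) := by
    intro i hi i' hi' hadj
    obtain ⟨a, _, rfl⟩ := Finset.mem_image.1 hi
    obtain ⟨b, _, rfl⟩ := Finset.mem_image.1 hi'
    have hcs : (j b).castSucc = (j a).succ := by
      simp only [Fin.ext_iff, Fin.val_castSucc, Fin.val_succ]; omega
    have hA := hj1 a
    have hB := hj1 b
    rw [hcs] at hB
    set x := f.symm {a, b} with hx
    have ha : pr v (j a) ∈ NN x.1 := by rw [← hmem, hx]; simp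
    have hb : pr v (j b) ∈ NN x.1 := by rw [← hmem, hx]; simp
    have hac : (v (j a).castSucc, v (j b).succ) ∈ NN x.1 := by
      rw [pr, mem_NN] at ha hb
      rw [mem_NN]
      rw [hcs] at hb
      exact ⟨hA.trans hB, hb.2.trans ha.2⟩
    have e1 : (v * ssw (j a)) (j b).castSucc = v (j a).castSucc := by
      rw [hcs, Perm.mul_apply, ssw_right]
    have e2 : (v * ssw (j a)) (j b).succ = v (j b).succ := by
      rw [Perm.mul_apply, ssw_other]
      all_goals (simp only [ne_eq, Fin.ext_iff, Fin.val_castSucc, Fin.val_succ]; omega)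
    have hy : NN (v * ssw (j a) * ssw (j b)) =
        insert (v (j a).castSucc, v (j b).succ) (insert (pr v (j a)) (NN v)) := by
      rw [NN_mul _ _ (by rw [e1, e2]; exact hA.trans hB), NN_mul _ _ hA, e1, e2]; rfl
    let y : {x : Perm (Fin (m + 1)) // NN v ⊆ NN x ∧ NN x ⊆ NN w} :=
      ⟨v * ssw (j a) * ssw (j b), by
        rw [hy]; exact (Finset.subset_insert _ _).trans (Finset.subset_insert _ _), by
        rw [hy]
        exact (Finset.insert_subset hac (Finset.insert_subset ha x.2.1)).trans x.2.2⟩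
    have hyx : f y ⊆ {a, b} := by
      have := (hf y x).1 (by
        show NN (v * ssw (j a) * ssw (j b)) ⊆ _
        rw [hy]
        exact Finset.insert_subset hac (Finset.insert_subset ha x.2.1))
      rwa [hx, f.apply_symm_apply] at this
    have hby : b ∉ f y := by
      rw [hmem]
      show _ ∉ NN (v * ssw (j a) * ssw (j b))
      rw [hy]
      simp only [Finset.mem_insert, not_or]
      refine ⟨?_, ?_, pr_notMem v _⟩
      · intro h
        have := congrArg Prod.fst h
        simp only [pr, hcs] at this
        exact hA.ne' this
      · intro h
        have := congrArg Prod.fst h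
        simp only [pr, hcs] at this
        exact hA.ne' this
    have hya : f y ⊆ {a} := by
      intro c hc
      have := hyx hc
      simp only [Finset.mem_insert, Finset.mem_singleton] at this ⊢
      rcases this with h | h
      · exact h
      · exact absurd (h ▸ hc) hby
    have h1 := (hf y (f.symm {a})).2 (by rw [f.apply_symm_apply]; exact hya)
    rw [hN] at h1
    have h2 : (v (j a).castSucc, v (j b).succ) ∈ insert (pr v (j a)) (NN v) := by
      apply h1
      show _ ∈ NN (v * ssw (j a) * ssw (j b))
      rw [hy]; exact Finset.mem_insert_self _ _
    rcases Finset.mem_insert.1 h2 with h3 | h3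
    · exact hB.ne' (congrArg Prod.snd h3)
    · rw [mem_NN'] at h3
      have := h3.2
      simp only [Fin.lt_def, Fin.val_castSucc, Fin.val_succ] at this
      omega
  refine ⟨Finset.univ.image j, hInd, hGood, ?_, ?_⟩
  · rw [Finset.card_image_of_injective _ hinj, Finset.card_univ, Fintype.card_fin]
  · obtain ⟨t, ht, _⟩ := exists_top v _ hInd hGood
    have htw : NN v ∪ VJ v (Finset.univ.image j) ⊆ NN w := by
      apply Finset.union_subset hvw
      intro p hp
      simp only [VJ, Finset.mem_image] at hp
      obtain ⟨_, ⟨a, _, rfl⟩, rfl⟩ := hp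
      have := (f.symm {a}).2.2
      rw [hN] at this
      exact this (Finset.mem_insert_self _ _)
    let t' : {x : Perm (Fin (m + 1)) // NN v ⊆ NN x ∧ NN x ⊆ NN w} :=
      ⟨t, by rw [ht]; exact Finset.subset_union_left, by rw [ht]; exact htw⟩
    have hft : f w' ⊆ f t' := by
      intro a _
      rw [hmem]
      show _ ∈ NN t
      rw [ht]
      apply Finset.mem_union_right
      rw [pr_mem_VJ]
      exact Finset.mem_image_of_mem _ (Finset.mem_univ _)
    have h1 : NN w ⊆ NN t := (hf w' t').2 hft
    rw [ht] at h1
    exact Finset.Subset.antisymm h1 htw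

theorem card_good {m : ℕ} (J : Finset (Fin m)) : Indep J →
    2 ^ J.card * Nat.card {v : Perm (Fin (m + 1)) // Good v J} = (m + 1).factorial := by
  induction J using Finset.induction_on with
  | empty =>
    intro _
    have e : {v : Perm (Fin (m + 1)) // Good v ∅} ≃ Perm (Fin (m + 1)) :=
      Equiv.subtypeUnivEquiv (fun v i hi => absurd hi (Finset.notMem_empty i))
    rw [Nat.card_congr e, Nat.card_eq_fintype_card, Fintype.card_perm, Fintype.card_fin]
    simp
  | insert j J hj ih =>
    intro hI
    have h1 := ih (hI.mono (Finset.subset_insert _ _))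
    rw [← h1, Finset.card_insert_of_notMem hj, pow_succ, mul_assoc]
    congr 1
    classical
    simp only [Nat.card_eq_fintype_card, Fintype.card_subtype]
    have hs : ∀ v : Perm (Fin (m + 1)), Good v J → Good (v * ssw j) J := by
      intro v hv i hi
      have := hI.sep hj i hi
      rw [Perm.mul_apply, Perm.mul_apply, ssw_other j _ this.1.1 this.1.2,
        ssw_other j _ this.2.1 this.2.2]
      exact hv i hi
    have hg : ∀ v, Good v (insert j J) ↔ Good v J ∧ v j.castSucc < v j.succ := by
      intro v
      simp only [Good, Finset.mem_insert, forall_eq_or_imp]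
      tauto
    have hbij : (Finset.univ.filter (fun v : Perm (Fin (m + 1)) =>
        Good v J ∧ v j.castSucc < v j.succ)).card = (Finset.univ.filter
        (fun v : Perm (Fin (m + 1)) => Good v J ∧ ¬ v j.castSucc < v j.succ)).card := by
      apply Finset.card_bij' (fun v _ => v * ssw j) (fun v _ => v * ssw j)
      · intro v hv
        simp only [Finset.mem_filter, Finset.mem_univ, true_and] at hv ⊢
        refine ⟨hs v hv.1, ?_⟩
        rw [Perm.mul_apply, Perm.mul_apply, ssw_left, ssw_right]
        exact hv.2.not_gt
      · intro v hv
        simp only [Finset.mem_filter, Finset.mem_univ, true_and] at hv ⊢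
        refine ⟨hs v hv.1, ?_⟩
        rw [Perm.mul_apply, Perm.mul_apply, ssw_left, ssw_right]
        refine lt_of_le_of_ne (not_lt.mp hv.2) ?_
        intro h'
        have := v.injective h'
        simp [Fin.ext_iff] at this
      · intro v _; simp only [mul_assoc, ssw_mul_self, mul_one]
      · intro v _; simp only [mul_assoc, ssw_mul_self, mul_one]
    have hsplit := Finset.card_filter_add_card_filter_not
      (s := Finset.univ.filter (fun v : Perm (Fin (m + 1)) => Good v J))
      (fun v => v j.castSucc < v j.succ)
    rw [Finset.filter_filter, Finset.filter_filter] at hsplit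
    simp only [hg]
    omega

theorem card_isB {m : ℕ} (k : ℕ) :
    Nat.card {p : Perm (Fin (m + 1)) × Perm (Fin (m + 1)) // IsB k p.1 p.2} =
    (m + 1).factorial / 2 ^ k * Nat.card {J : Finset (Fin m) // Indep J ∧ J.card = k} := by
  have hex : ∀ q : (Σ J : {J : Finset (Fin m) // Indep J ∧ J.card = k},
      {v : Perm (Fin (m + 1)) // Good v J.1}), ∃ w, NN w = NN q.2.1 ∪ VJ q.2.1 q.1.1 := by
    rintro ⟨J, v⟩
    obtain ⟨w, hw, _⟩ := exists_top v.1 J.1 J.2.1 v.2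
    exact ⟨w, hw⟩
  choose F hF using hex
  let G : (Σ J : {J : Finset (Fin m) // Indep J ∧ J.card = k},
      {v : Perm (Fin (m + 1)) // Good v J.1}) →
      {p : Perm (Fin (m + 1)) × Perm (Fin (m + 1)) // IsB k p.1 p.2} :=
    fun q => ⟨(q.2.1, F q), by
      have := isB_of q.2.1 (F q) q.1.1 q.1.2.1 q.2.2 (hF q)
      rwa [q.1.2.2] at this⟩
  have hG : Function.Bijective G := by
    constructor
    · rintro ⟨⟨J, hJ⟩, ⟨v, hv⟩⟩ ⟨⟨J', hJ'⟩, ⟨v', hv'⟩⟩ h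
      have h0 := congrArg Subtype.val h
      have h1 : v = v' := congrArg Prod.fst h0
      have h2 : F ⟨⟨J, hJ⟩, ⟨v, hv⟩⟩ = F ⟨⟨J', hJ'⟩, ⟨v', hv'⟩⟩ := congrArg Prod.snd h0
      subst h1
      have h3 := congrArg NN h2
      rw [hF, hF] at h3
      have h4 : J = J' := Finset.Subset.antisymm ((subset_iff_aux v J J').1 h3.le)
        ((subset_iff_aux v J' J).1 h3.ge)
      subst h4
      rfl
    · rintro ⟨⟨v, w⟩, hvw⟩
      obtain ⟨J, h1, h2, h3, h4⟩ := of_isB k v w hvw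
      refine ⟨⟨⟨J, h1, h3⟩, ⟨v, h2⟩⟩, Subtype.ext (Prod.ext rfl (NN_inj _ _ ?_))⟩
      show NN (F _) = NN w
      rw [hF, h4]
  classical
  rw [← Nat.card_congr (Equiv.ofBijective G hG), Nat.card_sigma]
  have : ∀ J : {J : Finset (Fin m) // Indep J ∧ J.card = k},
      Nat.card {v : Perm (Fin (m + 1)) // Good v J.1} = (m + 1).factorial / 2 ^ k := by
    intro J
    rw [← card_good J.1 J.2.1, J.2.2, Nat.mul_div_cancel_left _ (by positivity)]
  rw [Finset.sum_congr rfl (fun J _ => this J), Finset.sum_const, smul_eq_mul, Finset.card_univ,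
    ← Nat.card_eq_fintype_card, mul_comm]


/-- Sets of naturals below `m` of size `k` without consecutive elements. -/
def sparse (m k : ℕ) : Finset (Finset ℕ) :=
  (Finset.range m).powerset.filter (fun S => (∀ i ∈ S, i + 1 ∉ S) ∧ S.card = k)

theorem mem_sparse (m k : ℕ) (S : Finset ℕ) :
    S ∈ sparse m k ↔ (∀ i ∈ S, i < m) ∧ (∀ i ∈ S, i + 1 ∉ S) ∧ S.card = k := by
  simp [sparse, Finset.subset_iff]

theorem sparse_rec (m k : ℕ) :
    (sparse (m + 2) (k + 1)).card = (sparse (m + 1) (k + 1)).card + (sparse m k).card := by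
  rw [← Finset.card_filter_add_card_filter_not (s := sparse (m + 2) (k + 1)) (fun S => m + 1 ∉ S)]
  congr 1
  · congr 1
    ext S
    simp only [Finset.mem_filter, mem_sparse]
    constructor
    · rintro ⟨⟨h1, h2⟩, h3⟩
      refine ⟨fun i hi => ?_, h2⟩
      have := h1 i hi
      have : i ≠ m + 1 := fun e => h3 (e ▸ hi)
      omega
    · rintro ⟨h1, h2⟩
      refine ⟨⟨fun i hi => ?_, h2⟩, fun h => ?_⟩
      · have := h1 i hi; omega
      · have := h1 _ h; omega
  · refine Finset.card_bij' (fun S _ => S.erase (m + 1)) (fun S _ => insert (m + 1) S) ?_ ?_ ?_ ?_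
    · intro S hS
      simp only [Finset.mem_filter, mem_sparse, not_not] at hS ⊢
      obtain ⟨⟨h1, h2, h3⟩, h4⟩ := hS
      refine ⟨fun i hi => ?_, fun i hi h => ?_, ?_⟩
      · rw [Finset.mem_erase] at hi
        have a := h1 i hi.2
        have b := hi.1
        have c : i ≠ m := by rintro rfl; exact h2 _ hi.2 h4
        omega
      · exact h2 i (Finset.mem_of_mem_erase hi) (Finset.mem_of_mem_erase h)
      · rw [Finset.card_erase_of_mem h4, h3]; rfl
    · intro S hS
      simp only [Finset.mem_filter, mem_sparse, not_not] at hS ⊢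
      obtain ⟨h1, h2, h3⟩ := hS
      have hn : m + 1 ∉ S := fun h => by have := h1 _ h; omega
      refine ⟨⟨fun i hi => ?_, fun i hi h => ?_, ?_⟩, Finset.mem_insert_self _ _⟩
      · rcases Finset.mem_insert.1 hi with h | h
        · omega
        · have := h1 i h; omega
      · rcases Finset.mem_insert.1 hi with h5 | h5
        · rcases Finset.mem_insert.1 h with h6 | h6
          · omega
          · have := h1 _ h6; omega
        · rcases Finset.mem_insert.1 h with h6 | h6
          · have := h1 _ h5; omega
          · exact h2 i h5 h6
      · rw [Finset.card_insert_of_notMem hn, h3]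
    · intro S hS
      simp only [Finset.mem_filter, not_not] at hS
      exact Finset.insert_erase hS.2
    · intro S hS
      rw [mem_sparse] at hS
      exact Finset.erase_insert (fun h => by have := hS.1 _ h; omega)

theorem sparse_zero (m : ℕ) : (sparse m 0).card = 1 := by
  have : sparse m 0 = {∅} := by
    ext S
    rw [mem_sparse, Finset.mem_singleton, Finset.card_eq_zero]
    constructor
    · rintro ⟨_, _, h⟩; exact h
    · rintro rfl; simp
  rw [this]; rfl

theorem sparse_big (m k : ℕ) (h : m < k) : (sparse m k).card = 0 := by
  rw [Finset.card_eq_zero, Finset.eq_empty_iff_forall_notMem]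
  intro S hS
  rw [mem_sparse] at hS
  have : S ⊆ Finset.range m := fun i hi => Finset.mem_range.2 (hS.1 i hi)
  have := Finset.card_le_card this
  rw [Finset.card_range] at this
  omega

theorem sparse_card : ∀ m k : ℕ, (sparse m k).card = Nat.choose (m + 1 - k) k
  | m, 0 => by rw [sparse_zero]; simp
  | 0, k + 1 => by rw [sparse_big _ _ (by omega)]; simp
  | 1, 1 => by decide
  | 1, k + 2 => by
      rw [sparse_big _ _ (by omega)]
      exact (Nat.choose_eq_zero_of_lt (by omega)).symm
  | m + 2, k + 1 => by
      rw [sparse_rec, sparse_card (m + 1) (k + 1), sparse_card m k]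
      rcases Nat.lt_or_ge (m + 1) k with h | h
      · rw [Nat.choose_eq_zero_of_lt, Nat.choose_eq_zero_of_lt, Nat.choose_eq_zero_of_lt] <;> omega
      · have e1 : m + 2 + 1 - (k + 1) = (m + 1 - k) + 1 := by omega
        have e2 : m + 1 + 1 - (k + 1) = m + 1 - k := by omega
        rw [e1, e2, Nat.choose_succ_succ, add_comm]

theorem card_indep (m k : ℕ) :
    Nat.card {J : Finset (Fin m) // Indep J ∧ J.card = k} = Nat.choose (m + 1 - k) k := by
  rw [← sparse_card]
  classical
  rw [Nat.card_eq_fintype_card, Fintype.card_subtype]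
  apply Finset.card_bij (fun J _ => J.map Fin.valEmbedding)
  · intro J hJ
    simp only [Finset.mem_filter, Finset.mem_univ, true_and] at hJ
    rw [mem_sparse, Finset.card_map]
    refine ⟨?_, ?_, hJ.2⟩
    · intro i hi
      obtain ⟨a, _, rfl⟩ := Finset.mem_map.1 hi
      exact a.2
    · intro i hi h
      obtain ⟨a, ha, rfl⟩ := Finset.mem_map.1 hi
      obtain ⟨b, hb, hab⟩ := Finset.mem_map.1 h
      exact hJ.1 a ha b hb hab.symm
  · intro J _ J' _ h
    exact Finset.map_injective _ h
  · intro S hS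
    rw [mem_sparse] at hS
    have hS' : (Finset.univ.filter (fun i : Fin m => (i : ℕ) ∈ S)).map Fin.valEmbedding = S := by
      ext i
      simp only [Finset.mem_map, Finset.mem_filter, Finset.mem_univ, true_and,
        Fin.valEmbedding_apply]
      constructor
      · rintro ⟨a, ha, rfl⟩; exact ha
      · intro hi; exact ⟨⟨i, hS.1 i hi⟩, hi, rfl⟩
    refine ⟨Finset.univ.filter (fun i : Fin m => (i : ℕ) ∈ S), ?_, hS'⟩
    simp only [Finset.mem_filter, Finset.mem_univ, true_and]
    constructor
    · intro i hi j hj h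
      simp only [Finset.mem_filter, Finset.mem_univ, true_and] at hi hj
      exact hS.2.1 i hi (h ▸ hj)
    · rw [← hS.2.2]
      conv_rhs => rw [← hS']
      rw [Finset.card_map]

theorem isBoolean_iff {W : Type*} [Group W] {m : ℕ} (cs : CoxeterSystem (CoxeterMatrix.A m) W)
    (k : ℕ) (v w : W) : IsBooleanInterval cs k v w ↔ IsB k (phi cs v) (phi cs w) := by
  let e : W ≃ Perm (Fin (m + 1)) := Equiv.ofBijective (phi cs) ⟨phi_inj cs, phi_surj cs⟩
  have hle : ∀ a b : W, weakLE cs a b ↔ NN (phi cs a) ⊆ NN (phi cs b) := weakLE_iff_NN cs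
  let E : {x : W // weakLE cs v x ∧ weakLE cs x w} ≃
      {x : Perm (Fin (m + 1)) // NN (phi cs v) ⊆ NN x ∧ NN x ⊆ NN (phi cs w)} :=
    e.subtypeEquiv (fun a => by rw [hle, hle]; rfl)
  have hE : ∀ a, (E a).1 = phi cs a.1 := fun a => rfl
  unfold IsBooleanInterval IsB
  rw [hle]
  refine and_congr_right (fun _ => ?_)
  constructor
  · rintro ⟨f, hf⟩
    refine ⟨E.symm.trans f, fun a b => ?_⟩
    obtain ⟨a, rfl⟩ := E.surjective a
    obtain ⟨b, rfl⟩ := E.surjective b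
    rw [hE, hE, ← hle, hf]
    simp
  · rintro ⟨f, hf⟩
    refine ⟨E.trans f, fun a b => ?_⟩
    rw [hle, ← hE, ← hE, hf]
    rfl

theorem card_boolean_A {W : Type*} [Group W] (m k : ℕ)
    (cs : CoxeterSystem (CoxeterMatrix.A m) W) :
    Nat.card {p : W × W // IsBooleanInterval cs k p.1 p.2} =
      (m + 1).factorial / 2 ^ k * Nat.choose (m + 1 - k) k := by
  rw [← card_indep, ← card_isB]
  let e : W ≃ Perm (Fin (m + 1)) := Equiv.ofBijective (phi cs) ⟨phi_inj cs, phi_surj cs⟩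
  exact Nat.card_congr ((e.prodCongr e).subtypeEquiv (fun p => isBoolean_iff cs k p.1 p.2))

theorem card_booleanIntervals_typeA {W : Type*} [Group W] (n k : ℕ) (hn : 1 ≤ n)
    (cs : CoxeterSystem (CoxeterMatrix.Aₙ (n - 1)) W) :
    Nat.card {p : W × W // IsBooleanInterval cs k p.1 p.2} =
      n.factorial / 2 ^ k * Nat.choose (n - k) k := by
  obtain ⟨m, rfl⟩ : ∃ m, n = m + 1 := ⟨n - 1, by omega⟩
  exact card_boolean_A m k cs
end
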